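/- Let γ > 1, φ, ψ ∈ C¹_b(ℝ), μ > 1, and λ ≥ 0. Then there exist constants ε₀ > 0 and C > 0 such that for every 0 < ε ≤ ε₀, the Cauchy problem u_t − v_x = 0, v_t + p(u)_x = −(λ/(1+t)^μ) v with initial data (u(0,x), v(0,x)) = (1 + εφ(x), εψ(x)) admits a C¹_b solution with u positive on [0, C ε^{−1}] × ℝ; i.e., the lifespan satisfies T* ≥ C ε^{−1}. -/

import Mathlib

noncomputable section
open Real Set

/-- Partial derivative with respect to time of a function of `(t, x)`. -/
def pdt (f : ℝ → ℝ → ℝ) (t x : ℝ) : ℝ := deriv (fun τ => f τ x) t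

/-- Partial derivative with respect to space of a function of `(t, x)`. -/
def pdx (f : ℝ → ℝ → ℝ) (t x : ℝ) : ℝ := deriv (fun ξ => f t ξ) x

/-- The strip `[0,T] × ℝ`. -/
def strip (T : ℝ) : Set (ℝ × ℝ) := Set.Icc 0 T ×ˢ (Set.univ : Set ℝ)

/-- The half-space `[0,∞) × ℝ`. -/
def stripInf : Set (ℝ × ℝ) := Set.Ici (0 : ℝ) ×ˢ (Set.univ : Set ℝ)

/-- The pressure `p(u) = u^(-γ)/γ`. -/
def pres (γ u : ℝ) : ℝ := u ^ (-γ) / γ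

/-- The sound speed `c(u) = u^(-(γ+1)/2)`. -/
def cspeed (γ u : ℝ) : ℝ := u ^ (-(γ + 1) / 2)

/-- The first Riemann invariant `r = v - (2/(γ-1)) u^(-(γ-1)/2) + 2/(γ-1)`. -/
def rInv (γ u v : ℝ) : ℝ := v - (2 / (γ - 1)) * u ^ (-(γ - 1) / 2) + 2 / (γ - 1)

/-- The second Riemann invariant `s = v + (2/(γ-1)) u^(-(γ-1)/2) - 2/(γ-1)`. -/
def sInv (γ u v : ℝ) : ℝ := v + (2 / (γ - 1)) * u ^ (-(γ - 1) / 2) - 2 / (γ - 1)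

/-- `(u,v)` solves the damped compressible Euler system on the set `S`. -/
def IsEulerOn (γ lam μ : ℝ) (u v : ℝ → ℝ → ℝ) (S : Set (ℝ × ℝ)) : Prop :=
  ∀ p ∈ S, pdt u p.1 p.2 - pdx v p.1 p.2 = 0 ∧
    pdt v p.1 p.2 + pdx (fun t x => pres γ (u t x)) p.1 p.2
      = -(lam / (1 + p.1) ^ μ) * v p.1 p.2

/-- `f` is `C¹` on `S ⊆ ℝ × ℝ`. -/
def IsC1On (f : ℝ → ℝ → ℝ) (S : Set (ℝ × ℝ)) : Prop :=
  ContDiffOn ℝ 1 (fun p : ℝ × ℝ => f p.1 p.2) S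

/-- `f` is `C²` on `S ⊆ ℝ × ℝ`. -/
def IsC2On (f : ℝ → ℝ → ℝ) (S : Set (ℝ × ℝ)) : Prop :=
  ContDiffOn ℝ 2 (fun p : ℝ × ℝ => f p.1 p.2) S

/-- `f` is `C¹_b` on `S ⊆ ℝ × ℝ`: `C¹` with `f` and its first partials bounded. -/
def IsC1bOn (f : ℝ → ℝ → ℝ) (S : Set (ℝ × ℝ)) : Prop :=
  IsC1On f S ∧ ∃ M : ℝ, ∀ p ∈ S, |f p.1 p.2| + |pdt f p.1 p.2| + |pdx f p.1 p.2| ≤ M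

/-- `f : ℝ → ℝ` is `C¹_b`. -/
def IsC1b (f : ℝ → ℝ) : Prop :=
  ContDiff ℝ 1 f ∧ ∃ M : ℝ, ∀ x, |f x| + |deriv f x| ≤ M

/-- The damping coefficient `λ/(2(1+t)^μ)`. -/
def damp (lam μ t : ℝ) : ℝ := lam / (2 * (1 + t) ^ μ)

/-- `A(t) = exp(∫₀ᵗ λ/(2(1+τ)^μ) dτ)`. -/
def Afun (lam μ t : ℝ) : ℝ := Real.exp (∫ τ in (0 : ℝ)..t, damp lam μ τ)

/-- `θ_γ(u)`. -/
def theta (γ u : ℝ) : ℝ :=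
  if γ = 3 then Real.log u else (4 / (3 - γ)) * (u ^ ((3 - γ) / 4) - 1)

namespace DiagonalTransport

open Filter Topology MeasureTheory
open scoped BoundedContinuousFunction

/-- Data of a Cauchy problem `∂ₜ wᵢ + gᵢ(w) ∂ₓ wᵢ = a(t) bᵢ(w)` on `[0,T]`, together with
quantitative bounds making the problem well posed in `C¹`. -/
structure TransportData (ι : Type*) [Fintype ι] where
  speed : ι → (ι → ℝ) → ℝ
  source : ι → (ι → ℝ) →L[ℝ] ℝ
  coeff : ℝ → ℝ
  weight : ℝ → ℝ
  initial : ι → ℝ → ℝ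
  T : ℝ
  L : ℝ
  K : ℝ
  W : ℝ
  B : ℝ
  T_nonneg : 0 ≤ T
  L_nonneg : 0 ≤ L
  K_pos : 0 < K
  B_nonneg : 0 ≤ B
  contDiff_speed : ∀ i, ContDiff ℝ 1 (speed i)
  speed_lipschitz : ∀ i v v', |speed i v - speed i v'| ≤ L * ‖v - v'‖
  source_le : ∀ i v, |source i v| ≤ ‖v‖
  continuous_coeff : Continuous coeff
  coeff_nonneg : ∀ t, 0 ≤ coeff t
  hasDerivAt_weight : ∀ t, HasDerivAt weight (4 * (coeff t * weight t)) t
  weight_zero : weight 0 = 1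
  one_le_weight : ∀ t, 0 ≤ t → 1 ≤ weight t
  weight_le : ∀ t, 0 ≤ t → t ≤ T → weight t ≤ W
  contDiff_initial : ∀ i, ContDiff ℝ 1 (initial i)
  abs_initial_le : ∀ i x, |initial i x| ≤ B
  abs_deriv_initial_le : ∀ i x, |deriv (initial i) x| ≤ K
  small : 32 * (T * L * W * K) ≤ 1

namespace TransportData

variable {ι : Type*} [Fintype ι] (S : TransportData ι)

/-- Truncation of the time variable to `[0,T]`. -/
def clamp (t : ℝ) : ℝ := max 0 (min t S.T)

lemma clamp_nonneg (t : ℝ) : 0 ≤ S.clamp t := le_max_left _ _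

lemma clamp_le (t : ℝ) : S.clamp t ≤ S.T := max_le S.T_nonneg (min_le_right _ _)

lemma clamp_eq {t : ℝ} (h0 : 0 ≤ t) (hT : t ≤ S.T) : S.clamp t = t := by
  simp [clamp, h0, hT]

@[fun_prop]
lemma continuous_clamp : Continuous S.clamp := by unfold clamp; fun_prop

lemma one_le_W : 1 ≤ S.W := by
  have := S.weight_le 0 le_rfl S.T_nonneg
  rwa [S.weight_zero] at this

@[fun_prop]
lemma continuous_weight : Continuous S.weight :=
  continuous_iff_continuousAt.2 fun t => (S.hasDerivAt_weight t).continuousAt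

@[fun_prop]
lemma continuous_coeff' : Continuous S.coeff := S.continuous_coeff

@[fun_prop]
lemma continuous_speed (i : ι) : Continuous (S.speed i) := (S.contDiff_speed i).continuous

@[fun_prop]
lemma continuous_initial (i : ι) : Continuous (S.initial i) := (S.contDiff_initial i).continuous

lemma initial_lipschitz (i : ι) (x y : ℝ) : |S.initial i x - S.initial i y| ≤ S.K * |x - y| := by
  have := Convex.norm_image_sub_le_of_norm_deriv_le (f := S.initial i) (s := univ) (C := S.K)
    (fun z _ => (S.contDiff_initial i).differentiable one_ne_zero z)
    (fun z _ => S.abs_deriv_initial_le i z) convex_univ (mem_univ y) (mem_univ x)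
  simpa using this

lemma integral_coeff_mul_weight (t : ℝ) :
    ∫ τ in (0 : ℝ)..t, S.coeff τ * S.weight τ = (S.weight t - 1) / 4 := by
  have h : ∀ τ ∈ uIcc 0 t, HasDerivAt (fun τ => S.weight τ / 4) (S.coeff τ * S.weight τ) τ := by
    intro τ _
    convert! (S.hasDerivAt_weight τ).div_const 4 using 1
    ring
  rw [intervalIntegral.integral_eq_sub_of_hasDerivAt h
    (Continuous.intervalIntegrable (by fun_prop) _ _), S.weight_zero]
  ring

lemma abs_integral_coeff_le {h : ℝ → ℝ} {t δ : ℝ} (ht : 0 ≤ t) (hδ : 0 ≤ δ)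
    (hle : ∀ σ, 0 ≤ σ → σ ≤ t → |h σ| ≤ S.weight σ * δ) :
    |∫ τ in (0 : ℝ)..t, S.coeff τ * h τ| ≤ S.weight t * δ / 4 := by
  have h1 : ‖∫ τ in (0 : ℝ)..t, S.coeff τ * h τ‖
      ≤ ∫ τ in (0 : ℝ)..t, S.coeff τ * S.weight τ * δ := by
    refine intervalIntegral.norm_integral_le_of_norm_le ht ?_
      (Continuous.intervalIntegrable (by fun_prop) _ _)
    refine Eventually.of_forall fun σ hσ => ?_
    rw [norm_mul, Real.norm_eq_abs, Real.norm_eq_abs, abs_of_nonneg (S.coeff_nonneg σ), mul_assoc]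
    exact mul_le_mul_of_nonneg_left (hle σ hσ.1.le hσ.2) (S.coeff_nonneg σ)
  rw [intervalIntegral.integral_mul_const, integral_coeff_mul_weight, Real.norm_eq_abs] at h1
  linarith

lemma abs_integral_source_sub_le (i : ι) {u u' : ℝ → ι → ℝ} (hu : Continuous u)
    (hu' : Continuous u') {t δ : ℝ} (ht : 0 ≤ t) (hδ : 0 ≤ δ)
    (hle : ∀ σ, 0 ≤ σ → σ ≤ t → ‖u σ - u' σ‖ ≤ S.weight σ * δ) :
    |(∫ τ in (0 : ℝ)..t, S.coeff τ * S.source i (u τ)) -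
      ∫ τ in (0 : ℝ)..t, S.coeff τ * S.source i (u' τ)| ≤ S.weight t * δ / 4 := by
  rw [← intervalIntegral.integral_sub (Continuous.intervalIntegrable (by fun_prop) _ _)
    (Continuous.intervalIntegrable (by fun_prop) _ _)]
  simp_rw [← mul_sub, ← map_sub]
  exact S.abs_integral_coeff_le ht hδ fun σ h0 h1 => (S.source_le i _).trans (hle σ h0 h1)

lemma abs_integral_speed_sub_le (i : ι) {u u' : ℝ → ι → ℝ} (hu : Continuous u)
    (hu' : Continuous u') {l t δ : ℝ} (hl : 0 ≤ l) (hlt : l ≤ t) (ht : t ≤ S.T) (hδ : 0 ≤ δ)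
    (hle : ∀ σ, l ≤ σ → σ ≤ t → ‖u σ - u' σ‖ ≤ S.weight σ * δ) :
    |(∫ τ in l..t, S.speed i (u τ)) - ∫ τ in l..t, S.speed i (u' τ)| ≤ S.T * S.L * S.W * δ := by
  rw [← intervalIntegral.integral_sub (Continuous.intervalIntegrable (by fun_prop) _ _)
    (Continuous.intervalIntegrable (by fun_prop) _ _)]
  have hW := S.one_le_W
  have hL := S.L_nonneg
  have h := intervalIntegral.norm_integral_le_of_norm_le_const (a := l) (b := t)
    (f := fun τ => S.speed i (u τ) - S.speed i (u' τ)) (C := S.L * S.W * δ) (by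
      intro σ hσ
      rw [uIoc_of_le hlt] at hσ
      refine (S.speed_lipschitz i _ _).trans ?_
      rw [mul_assoc]
      refine mul_le_mul_of_nonneg_left ((hle σ hσ.1.le hσ.2).trans ?_) S.L_nonneg
      exact mul_le_mul_of_nonneg_right
        (S.weight_le σ (hl.trans hσ.1.le) (hσ.2.trans ht)) hδ)
  rw [Real.norm_eq_abs, abs_of_nonneg (by linarith : 0 ≤ t - l)] at h
  refine h.trans ?_
  calc S.L * S.W * δ * (t - l) ≤ S.L * S.W * δ * S.T := by gcongr; linarith
    _ = _ := by ring

/-- One Picard step for the transported unknown. -/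
def wStep (w : ℝ → ℝ → ι → ℝ) (X : ι → ℝ → ℝ → ℝ → ℝ) (t x : ℝ) (i : ι) : ℝ :=
  S.initial i (X i 0 t x) +
    ∫ τ in (0 : ℝ)..S.clamp t, S.coeff τ * S.source i (w τ (X i τ t x))

/-- One Picard step for the displacement along backward characteristics. -/
def shiftStep (w : ℝ → ℝ → ι → ℝ) (X : ι → ℝ → ℝ → ℝ → ℝ) (i : ι) (τ t x : ℝ) : ℝ :=
  ∫ σ in min (S.clamp τ) (S.clamp t)..S.clamp t, S.speed i (w σ (X i σ t x))

variable {S}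

lemma continuous_wStep {w : ℝ → ℝ → ι → ℝ} {X : ι → ℝ → ℝ → ℝ → ℝ}
    (hw : Continuous fun q : ℝ × ℝ => w q.1 q.2)
    (hX : ∀ i, Continuous fun q : ℝ × ℝ × ℝ => X i q.1 q.2.1 q.2.2) (i : ι) :
    Continuous fun q : ℝ × ℝ => S.wStep w X q.1 q.2 i := by
  have hXc := hX i
  have h2 : Continuous fun p : (ℝ × ℝ) × ℝ => w p.2 (X i p.2 p.1.1 p.1.2) :=
    hw.comp (continuous_snd.prodMk (hXc.comp (by fun_prop :
      Continuous fun p : (ℝ × ℝ) × ℝ => (p.2, p.1.1, p.1.2))))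
  refine ((S.continuous_initial i).comp (hXc.comp (by fun_prop :
      Continuous fun p : ℝ × ℝ => ((0 : ℝ), p.1, p.2)))).add ?_
  refine intervalIntegral.continuous_parametric_intervalIntegral_of_continuous
    (f := fun (p : ℝ × ℝ) τ => S.coeff τ * S.source i (w τ (X i τ p.1 p.2))) ?_ (by fun_prop)
  exact (by fun_prop : Continuous fun p : (ℝ × ℝ) × ℝ => S.coeff p.2).mul
    ((S.source i).continuous.comp h2)

lemma continuous_shiftStep {w : ℝ → ℝ → ι → ℝ} {X : ι → ℝ → ℝ → ℝ → ℝ}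
    (hw : Continuous fun q : ℝ × ℝ => w q.1 q.2)
    (hX : ∀ i, Continuous fun q : ℝ × ℝ × ℝ => X i q.1 q.2.1 q.2.2) (i : ι) :
    Continuous fun q : ℝ × ℝ × ℝ => S.shiftStep w X i q.1 q.2.1 q.2.2 := by
  have hXc := hX i
  have h2 : Continuous fun p : (ℝ × ℝ × ℝ) × ℝ =>
      S.speed i (w p.2 (X i p.2 p.1.2.1 p.1.2.2)) :=
    (S.continuous_speed i).comp (hw.comp (continuous_snd.prodMk (hXc.comp (by fun_prop :
      Continuous fun p : (ℝ × ℝ × ℝ) × ℝ => (p.2, p.1.2.1, p.1.2.2)))))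
  have h3 : ∀ q : ℝ × ℝ × ℝ, S.shiftStep w X i q.1 q.2.1 q.2.2 =
      (∫ σ in (0 : ℝ)..S.clamp q.2.1, S.speed i (w σ (X i σ q.2.1 q.2.2))) -
      ∫ σ in (0 : ℝ)..min (S.clamp q.1) (S.clamp q.2.1),
        S.speed i (w σ (X i σ q.2.1 q.2.2)) := by
    intro q
    have h4 : Continuous fun σ => S.speed i (w σ (X i σ q.2.1 q.2.2)) :=
      h2.comp (by fun_prop : Continuous fun σ : ℝ => (q, σ))
    rw [shiftStep, eq_comm, intervalIntegral.integral_interval_sub_left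
      (h4.intervalIntegrable _ _) (h4.intervalIntegrable _ _)]
  simp_rw [h3]
  exact (intervalIntegral.continuous_parametric_intervalIntegral_of_continuous
    (f := fun (q : ℝ × ℝ × ℝ) σ => S.speed i (w σ (X i σ q.2.1 q.2.2))) h2 (by fun_prop)).sub
    (intervalIntegral.continuous_parametric_intervalIntegral_of_continuous
    (f := fun (q : ℝ × ℝ × ℝ) σ => S.speed i (w σ (X i σ q.2.1 q.2.2))) h2 (by fun_prop))

/-- A Lipschitz solution of the integrated problem, together with its backward characteristics. -/
structure IsMildSolution (S : TransportData ι) (w : ℝ → ℝ → ι → ℝ)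
    (X : ι → ℝ → ℝ → ℝ → ℝ) : Prop where
  continuous_w : Continuous fun q : ℝ × ℝ => w q.1 q.2
  continuous_X : ∀ i, Continuous fun q : ℝ × ℝ × ℝ => X i q.1 q.2.1 q.2.2
  eq_w : ∀ t x i, w t x i = S.wStep w X t x i
  eq_X : ∀ i τ t x, X i τ t x = x - S.shiftStep w X i τ t x
  lipschitz_w : ∀ t x y, ‖w t x - w t y‖ ≤ S.weight (S.clamp t) * (4 * S.K * |x - y|)
  lipschitz_X : ∀ i τ t x y, |(X i τ t x - X i τ t y) - (x - y)| ≤ |x - y| / 2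
  norm_w_le : ∀ t x, ‖w t x‖ ≤ 2 * S.B * S.W

lemma abs_wStep_sub_le {w w' : ℝ → ℝ → ι → ℝ} {X X' : ι → ℝ → ℝ → ℝ → ℝ}
    (hw : Continuous fun q : ℝ × ℝ => w q.1 q.2)
    (hw' : Continuous fun q : ℝ × ℝ => w' q.1 q.2)
    (hX : ∀ i, Continuous fun q : ℝ × ℝ × ℝ => X i q.1 q.2.1 q.2.2)
    (hX' : ∀ i, Continuous fun q : ℝ × ℝ × ℝ => X' i q.1 q.2.1 q.2.2)
    (i : ι) (t x x' : ℝ) {δ₂ δ : ℝ} (hδ : 0 ≤ δ) (h2 : |X i 0 t x - X' i 0 t x'| ≤ δ₂)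
    (h : ∀ σ, 0 ≤ σ → σ ≤ S.T → ‖w σ (X i σ t x) - w' σ (X' i σ t x')‖ ≤ S.weight σ * δ) :
    |S.wStep w X t x i - S.wStep w' X' t x' i| ≤ S.K * δ₂ + S.weight (S.clamp t) * δ / 4 := by
  have h1 := (S.initial_lipschitz i (X i 0 t x) (X' i 0 t x')).trans
    (mul_le_mul_of_nonneg_left h2 S.K_pos.le)
  have hu : Continuous fun σ => w σ (X i σ t x) :=
    hw.comp (continuous_id.prodMk ((hX i).comp (by fun_prop : Continuous fun σ : ℝ => (σ, t, x))))
  have hu' : Continuous fun σ => w' σ (X' i σ t x') :=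
    hw'.comp (continuous_id.prodMk
      ((hX' i).comp (by fun_prop : Continuous fun σ : ℝ => (σ, t, x'))))
  have h3 := S.abs_integral_source_sub_le i hu hu' (S.clamp_nonneg t) hδ
    fun σ h0 h1 => h σ h0 (h1.trans (S.clamp_le t))
  unfold wStep
  rw [abs_le] at *
  constructor <;> linarith [h1.1, h1.2, h3.1, h3.2]

lemma abs_shiftStep_sub_le {w w' : ℝ → ℝ → ι → ℝ} {X X' : ι → ℝ → ℝ → ℝ → ℝ}
    (hw : Continuous fun q : ℝ × ℝ => w q.1 q.2)
    (hw' : Continuous fun q : ℝ × ℝ => w' q.1 q.2)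
    (hX : ∀ i, Continuous fun q : ℝ × ℝ × ℝ => X i q.1 q.2.1 q.2.2)
    (hX' : ∀ i, Continuous fun q : ℝ × ℝ × ℝ => X' i q.1 q.2.1 q.2.2)
    (i : ι) (τ t x x' : ℝ) {δ : ℝ} (hδ : 0 ≤ δ)
    (h : ∀ σ, 0 ≤ σ → σ ≤ S.T → ‖w σ (X i σ t x) - w' σ (X' i σ t x')‖ ≤ S.weight σ * δ) :
    |S.shiftStep w X i τ t x - S.shiftStep w' X' i τ t x'| ≤ S.T * S.L * S.W * δ := by
  have hu : Continuous fun σ => w σ (X i σ t x) :=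
    hw.comp (continuous_id.prodMk ((hX i).comp (by fun_prop : Continuous fun σ : ℝ => (σ, t, x))))
  have hu' : Continuous fun σ => w' σ (X' i σ t x') :=
    hw'.comp (continuous_id.prodMk
      ((hX' i).comp (by fun_prop : Continuous fun σ : ℝ => (σ, t, x'))))
  have h0 : 0 ≤ min (S.clamp τ) (S.clamp t) := le_min (S.clamp_nonneg _) (S.clamp_nonneg _)
  exact S.abs_integral_speed_sub_le i hu hu' h0 (min_le_right _ _) (S.clamp_le t) hδ
    fun σ h1 h2 => h σ (h0.trans h1) (h2.trans (S.clamp_le t))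

variable (S) in
/-- The space on which the Picard map is iterated: rescaled unknown and rescaled displacement. -/
abbrev PicardSpace (_ : TransportData ι) : Type _ :=
  ((ℝ × ℝ) →ᵇ (ι → ℝ)) × ((ℝ × ℝ × ℝ) →ᵇ (ι → ℝ))

variable (S) in
def wOf (p : S.PicardSpace) (t x : ℝ) (i : ι) : ℝ := S.weight (S.clamp t) * p.1 (t, x) i

variable (S) in
def XOf (p : S.PicardSpace) (i : ι) (τ t x : ℝ) : ℝ := x - p.2 (τ, t, x) i / (8 * S.K)

lemma continuous_wOf (p : S.PicardSpace) :
    Continuous fun q : ℝ × ℝ => S.wOf p q.1 q.2 := by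
  refine continuous_pi fun i => ?_
  exact (by fun_prop : Continuous fun q : ℝ × ℝ => S.weight (S.clamp q.1)).mul
    ((continuous_apply i).comp p.1.continuous)

lemma continuous_XOf (p : S.PicardSpace) (i : ι) :
    Continuous fun q : ℝ × ℝ × ℝ => S.XOf p i q.1 q.2.1 q.2.2 :=
  (by fun_prop : Continuous fun q : ℝ × ℝ × ℝ => q.2.2).sub
    (((continuous_apply i).comp p.2.continuous).div_const _)

lemma weight_clamp_pos (S : TransportData ι) (t : ℝ) : 0 < S.weight (S.clamp t) :=
  one_pos.trans_le (S.one_le_weight _ (S.clamp_nonneg t))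

lemma norm_wOf_le (p : S.PicardSpace) (t x : ℝ) :
    ‖S.wOf p t x‖ ≤ S.weight (S.clamp t) * ‖p.1‖ := by
  have := (S.weight_clamp_pos t).le
  refine (pi_norm_le_iff_of_nonneg (by positivity)).2 fun i => ?_
  rw [wOf, norm_mul, Real.norm_of_nonneg this]
  gcongr
  exact (norm_le_pi_norm _ i).trans (p.1.norm_coe_le_norm _)

lemma abs_wStep_wOf_le (p : S.PicardSpace) (t x : ℝ) (i : ι) :
    |S.wStep (S.wOf p) (S.XOf p) t x i| ≤ S.B + S.weight (S.clamp t) * ‖p.1‖ / 4 := by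
  refine (abs_add_le _ _).trans (add_le_add (S.abs_initial_le _ _) ?_)
  refine S.abs_integral_coeff_le (S.clamp_nonneg t) (norm_nonneg _) fun σ h0 h1 => ?_
  refine (S.source_le i _).trans ((norm_wOf_le p σ _).trans ?_)
  rw [S.clamp_eq h0 (h1.trans (S.clamp_le t))]

variable (S) in
def picardFst (p : S.PicardSpace) : (ℝ × ℝ) →ᵇ (ι → ℝ) :=
  BoundedContinuousFunction.ofNormedAddCommGroup
    (fun q i => (S.weight (S.clamp q.1))⁻¹ * S.wStep (S.wOf p) (S.XOf p) q.1 q.2 i)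
    (continuous_pi fun i => (Continuous.inv₀ (by fun_prop)
      fun q => (S.weight_clamp_pos q.1).ne').mul
      (continuous_wStep (continuous_wOf p) (continuous_XOf p) i))
    (S.B + ‖p.1‖ / 4) (by
      intro q
      have hB := S.B_nonneg
      refine (pi_norm_le_iff_of_nonneg (by positivity)).2 fun i => ?_
      have h1 := S.one_le_weight _ (S.clamp_nonneg q.1)
      have h0 := S.weight_clamp_pos q.1
      rw [norm_mul, norm_inv, Real.norm_of_nonneg h0.le, inv_mul_le_iff₀ h0]
      refine (abs_wStep_wOf_le p _ _ _).trans ?_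
      nlinarith [norm_nonneg p.1])

variable (S) in
def picardSnd (p : S.PicardSpace) : (ℝ × ℝ × ℝ) →ᵇ (ι → ℝ) :=
  BoundedContinuousFunction.ofNormedAddCommGroup
    (fun q i => 8 * S.K * S.shiftStep (S.wOf p) (S.XOf p) i q.1 q.2.1 q.2.2)
    (continuous_pi fun i => continuous_const.mul
      (continuous_shiftStep (continuous_wOf p) (continuous_XOf p) i))
    (8 * S.K * ((‖fun i => S.speed i 0‖ + S.L * (S.W * ‖p.1‖)) * S.T)) (by
      intro q
      have hK := S.K_pos
      have hT := S.T_nonneg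
      have hL := S.L_nonneg
      have hW := S.one_le_W
      refine (pi_norm_le_iff_of_nonneg (by positivity)).2 fun i => ?_
      rw [norm_mul, Real.norm_of_nonneg (by positivity : 0 ≤ 8 * S.K)]
      gcongr
      have hl : 0 ≤ min (S.clamp q.1) (S.clamp q.2.1) :=
        le_min (S.clamp_nonneg _) (S.clamp_nonneg _)
      have hlt : min (S.clamp q.1) (S.clamp q.2.1) ≤ S.clamp q.2.1 := min_le_right _ _
      have htT := S.clamp_le q.2.1
      refine (intervalIntegral.norm_integral_le_of_norm_le_const
        (C := ‖fun i => S.speed i 0‖ + S.L * (S.W * ‖p.1‖)) ?_).trans ?_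
      · intro σ hσ
        rw [uIoc_of_le hlt] at hσ
        have h1 := norm_le_pi_norm (fun i => S.speed i 0) i
        have h2 := S.speed_lipschitz i (S.wOf p σ (S.XOf p i σ q.2.1 q.2.2)) 0
        rw [sub_zero] at h2
        have h3 := (norm_wOf_le p σ (S.XOf p i σ q.2.1 q.2.2)).trans
          (mul_le_mul_of_nonneg_right (S.weight_le _ (S.clamp_nonneg σ) (S.clamp_le σ))
            (norm_nonneg _))
        have h4 := mul_le_mul_of_nonneg_left h3 hL
        have h5 := abs_sub_abs_le_abs_sub
          (S.speed i (S.wOf p σ (S.XOf p i σ q.2.1 q.2.2))) (S.speed i 0)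
        simp only [Real.norm_eq_abs] at h1 ⊢
        linarith
      · rw [abs_of_nonneg (by linarith)]
        gcongr
        linarith)

/-- Invariant set of the Picard map. -/
def lipschitzSet (S : TransportData ι) : Set S.PicardSpace :=
  {p | (∀ t x y i, |p.1 (t, x) i - p.1 (t, y) i| ≤ 4 * S.K * |x - y|) ∧
    ∀ τ t x y i, |p.2 (τ, t, x) i - p.2 (τ, t, y) i| ≤ 4 * S.K * |x - y|}

lemma isClosed_lipschitzSet : IsClosed S.lipschitzSet := by
  have h1 : ∀ q i, Continuous fun p : S.PicardSpace => p.1 q i := fun q i =>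
    (continuous_apply i).comp
      ((continuous_eval_const q).comp continuous_fst)
  have h2 : ∀ q i, Continuous fun p : S.PicardSpace => p.2 q i := fun q i =>
    (continuous_apply i).comp
      ((continuous_eval_const q).comp continuous_snd)
  simp only [lipschitzSet, ofPred_and, ofPred_forall]
  refine IsClosed.inter ?_ ?_
  · exact isClosed_iInter fun t => isClosed_iInter fun x => isClosed_iInter fun y =>
      isClosed_iInter fun i => isClosed_le ((h1 _ i).sub (h1 _ i)).abs continuous_const
  · exact isClosed_iInter fun τ => isClosed_iInter fun t => isClosed_iInter fun x =>
      isClosed_iInter fun y => isClosed_iInter fun i =>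
        isClosed_le ((h2 _ i).sub (h2 _ i)).abs continuous_const

lemma abs_XOf_sub_le {p p' : S.PicardSpace} (hp : p ∈ S.lipschitzSet) (i : ι) (τ t x x' : ℝ) :
    |S.XOf p i τ t x - S.XOf p' i τ t x'| ≤ 3 / 2 * |x - x'| + dist p p' / (8 * S.K) := by
  have hK := S.K_pos
  have h1 := hp.2 τ t x x' i
  have h2 : |p.2 (τ, t, x') i - p'.2 (τ, t, x') i| ≤ dist p p' :=
    (dist_le_pi_dist (p.2 (τ, t, x')) (p'.2 (τ, t, x')) i).trans
      ((BoundedContinuousFunction.dist_coe_le_dist _).trans (le_max_right _ _))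
  have h3 : S.XOf p i τ t x - S.XOf p' i τ t x' = (x - x') -
      ((p.2 (τ, t, x) i - p.2 (τ, t, x') i) + (p.2 (τ, t, x') i - p'.2 (τ, t, x') i)) /
        (8 * S.K) := by
    simp only [XOf]; ring
  rw [h3]
  refine (abs_sub _ _).trans ?_
  rw [abs_div, abs_of_pos (by positivity : 0 < 8 * S.K)]
  have h4 : |(p.2 (τ, t, x) i - p.2 (τ, t, x') i) + (p.2 (τ, t, x') i - p'.2 (τ, t, x') i)| /
      (8 * S.K) ≤ (4 * S.K * |x - x'| + dist p p') / (8 * S.K) := by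
    gcongr
    exact (abs_add_le _ _).trans (add_le_add h1 h2)
  refine (add_le_add_right h4 _).trans (le_of_eq ?_)
  field_simp
  ring

lemma norm_wOf_sub_le {p p' : S.PicardSpace} (hp : p ∈ S.lipschitzSet) (t y y' : ℝ) :
    ‖S.wOf p t y - S.wOf p' t y'‖ ≤ S.weight (S.clamp t) * (4 * S.K * |y - y'| + dist p p') := by
  have hK := S.K_pos
  have hw := (S.weight_clamp_pos t).le
  refine (pi_norm_le_iff_of_nonneg (by positivity)).2 fun i => ?_
  have h1 := hp.1 t y y' i
  have h2 : |p.1 (t, y') i - p'.1 (t, y') i| ≤ dist p p' :=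
    (dist_le_pi_dist (p.1 (t, y')) (p'.1 (t, y')) i).trans
      ((BoundedContinuousFunction.dist_coe_le_dist _).trans (le_max_left _ _))
  rw [Pi.sub_apply, wOf, wOf, ← mul_sub, norm_mul, Real.norm_of_nonneg hw]
  gcongr
  exact (abs_sub_le _ (p.1 (t, y') i) _).trans (add_le_add h1 h2)

lemma norm_wOf_XOf_sub_le {p p' : S.PicardSpace} (hp : p ∈ S.lipschitzSet) (i : ι) (t x x' : ℝ)
    (σ : ℝ) (h0 : 0 ≤ σ) (h1 : σ ≤ S.T) :
    ‖S.wOf p σ (S.XOf p i σ t x) - S.wOf p' σ (S.XOf p' i σ t x')‖ ≤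
      S.weight σ * (6 * S.K * |x - x'| + 3 / 2 * dist p p') := by
  have hK := S.K_pos
  have h2 := norm_wOf_sub_le (p' := p') hp σ (S.XOf p i σ t x) (S.XOf p' i σ t x')
  have h3 := mul_le_mul_of_nonneg_left (abs_XOf_sub_le (p' := p') hp i σ t x x')
    (by positivity : 0 ≤ 4 * S.K)
  have h4 : 4 * S.K * (3 / 2 * |x - x'| + dist p p' / (8 * S.K)) =
      6 * S.K * |x - x'| + dist p p' / 2 := by
    field_simp; ring
  rw [S.clamp_eq h0 h1] at h2
  refine h2.trans (mul_le_mul_of_nonneg_left ?_ (one_pos.le.trans (S.one_le_weight σ h0)))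
  linarith

lemma abs_picardFst_sub_le {p p' : S.PicardSpace} (hp : p ∈ S.lipschitzSet) (t x x' : ℝ) (i : ι) :
    |S.picardFst p (t, x) i - S.picardFst p' (t, x') i| ≤
      3 * S.K * |x - x'| + dist p p' / 2 := by
  have hK := S.K_pos
  have h1 := abs_wStep_sub_le (S := S) (continuous_wOf p) (continuous_wOf p') (continuous_XOf p)
    (continuous_XOf p') i t x x' (by positivity) (abs_XOf_sub_le (p' := p') hp i 0 t x x')
    (norm_wOf_XOf_sub_le hp i t x x')
  have hpos := S.weight_clamp_pos t
  change |(S.weight (S.clamp t))⁻¹ * _ - (S.weight (S.clamp t))⁻¹ * _| ≤ _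
  rw [← mul_sub, abs_mul, abs_inv, abs_of_pos hpos, inv_mul_le_iff₀ hpos]
  refine h1.trans ?_
  have h4 : S.K * (3 / 2 * |x - x'| + dist p p' / (8 * S.K)) =
      3 / 2 * S.K * |x - x'| + dist p p' / 8 := by
    field_simp
  rw [h4]
  have h5 : 0 ≤ 3 / 2 * S.K * |x - x'| + dist p p' / 8 := by positivity
  nlinarith [S.one_le_weight _ (S.clamp_nonneg t)]

lemma abs_picardSnd_sub_le {p p' : S.PicardSpace} (hp : p ∈ S.lipschitzSet) (τ t x x' : ℝ)
    (i : ι) :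
    |S.picardSnd p (τ, t, x) i - S.picardSnd p' (τ, t, x') i| ≤
      3 * S.K * |x - x'| + dist p p' / 2 := by
  have hK := S.K_pos
  have h1 := abs_shiftStep_sub_le (S := S) (continuous_wOf p) (continuous_wOf p')
    (continuous_XOf p) (continuous_XOf p') i τ t x x' (by positivity)
    (norm_wOf_XOf_sub_le hp i t x x')
  change |8 * S.K * _ - 8 * S.K * _| ≤ _
  rw [← mul_sub, abs_mul, abs_of_pos (by positivity : 0 < 8 * S.K)]
  have h2 := mul_le_mul_of_nonneg_left h1 (by positivity : 0 ≤ 8 * S.K)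
  have h3 : 0 ≤ 6 * S.K * |x - x'| + 3 / 2 * dist p p' := by positivity
  have h4 : 0 ≤ S.K * |x - x'| := by positivity
  have h5 := mul_le_mul_of_nonneg_right S.small h3
  linarith [dist_nonneg (x := p) (y := p')]

theorem exists_isMildSolution (S : TransportData ι) : ∃ w X, S.IsMildSolution w X := by
  let F : S.PicardSpace → S.PicardSpace := fun p => (S.picardFst p, S.picardSnd p)
  have hK := S.K_pos
  have hmaps : MapsTo F S.lipschitzSet S.lipschitzSet := by
    intro p hp
    refine ⟨fun t x y i => ?_, fun τ t x y i => ?_⟩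
    · have := abs_picardFst_sub_le (p' := p) hp t x y i
      rw [dist_self] at this
      exact this.trans (by nlinarith [abs_nonneg (x - y)])
    · have := abs_picardSnd_sub_le (p' := p) hp τ t x y i
      rw [dist_self] at this
      exact this.trans (by nlinarith [abs_nonneg (x - y)])
  have hcontr : ContractingWith (1 / 2) (hmaps.restrict F S.lipschitzSet S.lipschitzSet) := by
    refine ⟨by rw [← NNReal.coe_lt_coe]; norm_num, LipschitzWith.of_dist_le_mul ?_⟩
    rintro ⟨p, hp⟩ ⟨p', hp'⟩
    have hd : (0 : ℝ) ≤ dist p p' / 2 := by positivity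
    have h : dist (F p) (F p') ≤ dist p p' / 2 := by
      refine max_le ?_ ?_
      · refine (BoundedContinuousFunction.dist_le hd).2 fun q => (dist_pi_le_iff hd).2 fun i => ?_
        have := abs_picardFst_sub_le (p' := p') hp q.1 q.2 q.2 i
        rwa [sub_self, abs_zero, mul_zero, zero_add] at this
      · refine (BoundedContinuousFunction.dist_le hd).2 fun q => (dist_pi_le_iff hd).2 fun i => ?_
        have := abs_picardSnd_sub_le (p' := p') hp q.1 q.2.1 q.2.2 q.2.2 i
        rwa [sub_self, abs_zero, mul_zero, zero_add] at this
    calc dist (F p) (F p') ≤ dist p p' / 2 := h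
      _ = _ := by rw [Subtype.dist_eq]; push_cast; ring
  have h0 : (0 : S.PicardSpace) ∈ S.lipschitzSet := by
    constructor <;> intros <;> simp <;> positivity
  obtain ⟨p, hp, hfix, -⟩ := hcontr.exists_fixedPoint'
    isClosed_lipschitzSet.isComplete hmaps h0 (edist_ne_top _ _)
  have h1 : S.picardFst p = p.1 := congrArg Prod.fst hfix
  have h2 : S.picardSnd p = p.2 := congrArg Prod.snd hfix
  have hbound : ‖p.1‖ ≤ 2 * S.B := by
    have h3 : ‖S.picardFst p‖ ≤ S.B + ‖p.1‖ / 4 :=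
      BoundedContinuousFunction.norm_ofNormedAddCommGroup_le _
        (by have := S.B_nonneg; positivity) _
    rw [h1] at h3
    linarith [norm_nonneg p.1, S.B_nonneg]
  refine ⟨S.wOf p, S.XOf p, continuous_wOf p, continuous_XOf p, ?_, ?_, ?_, ?_, ?_⟩
  · intro t x i
    have h3 : p.1 (t, x) i = (S.weight (S.clamp t))⁻¹ * S.wStep (S.wOf p) (S.XOf p) t x i := by
      nth_rewrite 1 [← h1]; rfl
    rw [wOf, h3, mul_inv_cancel_left₀ (S.weight_clamp_pos t).ne']
  · intro i τ t x
    have h3 : p.2 (τ, t, x) i = 8 * S.K * S.shiftStep (S.wOf p) (S.XOf p) i τ t x := by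
      nth_rewrite 1 [← h2]; rfl
    rw [XOf, h3, mul_div_cancel_left₀ _ (by positivity)]
  · intro t x y
    have := norm_wOf_sub_le (p' := p) hp t x y
    rwa [dist_self, add_zero] at this
  · intro i τ t x y
    have h3 : (S.XOf p i τ t x - S.XOf p i τ t y) - (x - y) =
        -((p.2 (τ, t, x) i - p.2 (τ, t, y) i) / (8 * S.K)) := by
      simp only [XOf]; ring
    rw [h3, abs_neg, abs_div, abs_of_pos (by positivity : 0 < 8 * S.K),
      div_le_iff₀ (by positivity)]
    refine (hp.2 τ t x y i).trans (le_of_eq ?_)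
    ring
  · intro t x
    refine (norm_wOf_le p t x).trans ?_
    rw [mul_comm]
    exact mul_le_mul hbound (S.weight_le _ (S.clamp_nonneg t) (S.clamp_le t))
      (S.weight_clamp_pos t).le (by have := S.B_nonneg; positivity)

end TransportData

section Oscillation

variable {E : Type*} [NormedAddCommGroup E] [NormedSpace ℝ E]

/-- Difference quotient in space of a function of `(t, x)`, at `q = (t, x, y)`. -/
def dq (u : ℝ → ℝ → E) (q : ℝ × ℝ × ℝ) : E := (q.2.2 - q.2.1)⁻¹ • (u q.1 q.2.2 - u q.1 q.2.1)

/-- Triples `(t', x', y')` tending to `(t, x, x)` with `x' ≠ y'`. -/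
def offDiag (t x : ℝ) : Filter (ℝ × ℝ × ℝ) := 𝓝[{q | q.2.1 ≠ q.2.2}] (t, x, x)

instance (t x : ℝ) : (offDiag t x).IsCountablyGenerated := by
  unfold offDiag nhdsWithin; infer_instance

instance offDiag_neBot (t x : ℝ) : (offDiag t x).NeBot := by
  have h : Tendsto (fun y : ℝ => (t, x, y)) (𝓝[≠] x) (offDiag t x) := by
    refine tendsto_nhdsWithin_iff.2 ⟨?_, ?_⟩
    · exact ((by fun_prop : Continuous fun y : ℝ => (t, x, y)).tendsto x).mono_left
        nhdsWithin_le_nhds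
    · filter_upwards [self_mem_nhdsWithin] with y hy using fun h => hy h.symm
  exact h.neBot

lemma eventually_offDiag_ne (t x : ℝ) : ∀ᶠ q in offDiag t x, q.2.1 ≠ q.2.2 :=
  self_mem_nhdsWithin

lemma offDiag_le (t x : ℝ) : offDiag t x ≤ 𝓝 (t, x, x) := nhdsWithin_le_nhds

/-- The oscillation of the difference quotients of `u` at `(t, x)` is at most `c`. -/
def OscLE (u : ℝ → ℝ → E) (t x c : ℝ) : Prop :=
  ∀ c' > c, ∀ᶠ r in offDiag t x ×ˢ offDiag t x, ‖dq u r.1 - dq u r.2‖ ≤ c'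

lemma OscLE.mono {u : ℝ → ℝ → E} {t x c c' : ℝ} (h : OscLE u t x c) (hc : c ≤ c') :
    OscLE u t x c' := fun d hd => h d (hc.trans_lt hd)

lemma OscLE.add {u v : ℝ → ℝ → E} {t x c d : ℝ} (hu : OscLE u t x c) (hv : OscLE v t x d) :
    OscLE (fun t x => u t x + v t x) t x (c + d) := by
  intro e he
  filter_upwards [hu (c + (e - c - d) / 2) (by linarith), hv (d + (e - c - d) / 2) (by linarith)]
    with r h1 h2
  have h3 : ∀ q, dq (fun t x => u t x + v t x) q = dq u q + dq v q := by
    intro q; simp only [dq, ← smul_add]; congr 1; abel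
  rw [h3, h3, add_sub_add_comm]
  exact (norm_add_le _ _).trans (by linarith)

lemma OscLE.neg {u : ℝ → ℝ → E} {t x c : ℝ} (hu : OscLE u t x c) :
    OscLE (fun t x => -u t x) t x c := by
  intro e he
  filter_upwards [hu e he] with r h1
  have h3 : ∀ q, dq (fun t x => -u t x) q = -dq u q := by
    intro q; simp only [dq, ← smul_neg]; congr 1; abel
  rwa [h3, h3, neg_sub_neg, norm_sub_rev]

lemma oscLE_of_tendsto {u : ℝ → ℝ → E} {t x : ℝ} {m : E}
    (h : Tendsto (dq u) (offDiag t x) (𝓝 m)) : OscLE u t x 0 := by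
  intro c hc
  have h1 : Tendsto (fun r : (ℝ × ℝ × ℝ) × (ℝ × ℝ × ℝ) => dq u r.1 - dq u r.2)
      (offDiag t x ×ˢ offDiag t x) (𝓝 (m - m)) :=
    (h.comp tendsto_fst).sub (h.comp tendsto_snd)
  rw [sub_self] at h1
  exact (h1.norm.eventually (ge_mem_nhds (by rwa [norm_zero])))

lemma tendsto_dq_comp_sub {G : E → ℝ} {G' : E →L[ℝ] ℝ} {u : ℝ → ℝ → E} {t x C : ℝ}
    (hG : HasStrictFDerivAt G G' (u t x)) (hu : Continuous fun p : ℝ × ℝ => u p.1 p.2)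
    (hC : ∀ q, ‖dq u q‖ ≤ C) :
    Tendsto (fun q => dq (fun t x => G (u t x)) q - G' (dq u q)) (offDiag t x) (𝓝 0) := by
  have hC0 : 0 ≤ C := (norm_nonneg _).trans (hC (0, 0, 0))
  have h1 : Tendsto (fun q : ℝ × ℝ × ℝ => (u q.1 q.2.2, u q.1 q.2.1)) (offDiag t x)
      (𝓝 (u t x, u t x)) := by
    have h : Continuous fun q : ℝ × ℝ × ℝ => (u q.1 q.2.2, u q.1 q.2.1) :=
      (hu.comp (by fun_prop : Continuous fun q : ℝ × ℝ × ℝ => (q.1, q.2.2))).prodMk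
        (hu.comp (by fun_prop : Continuous fun q : ℝ × ℝ × ℝ => (q.1, q.2.1)))
    exact (h.tendsto (t, x, x)).mono_left (offDiag_le t x)
  rw [Metric.tendsto_nhds]
  intro ε hε
  have h2 := h1.eventually (hG.isLittleO.def (by positivity : 0 < ε / (2 * (C + 1))))
  filter_upwards [h2, eventually_offDiag_ne t x] with q hq hne
  have hne' : 0 < |q.2.2 - q.2.1| := abs_pos.2 (sub_ne_zero.2 hne.symm)
  have h3 : dq (fun t x => G (u t x)) q - G' (dq u q) = (q.2.2 - q.2.1)⁻¹ *
      (G (u q.1 q.2.2) - G (u q.1 q.2.1) - G' (u q.1 q.2.2 - u q.1 q.2.1)) := by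
    simp only [dq, map_smul, smul_eq_mul]; ring
  have h4 : ‖u q.1 q.2.2 - u q.1 q.2.1‖ = |q.2.2 - q.2.1| * ‖dq u q‖ := by
    rw [dq, norm_smul, norm_inv, Real.norm_eq_abs, mul_inv_cancel_left₀ hne'.ne']
  rw [dist_zero_right, h3, norm_mul, norm_inv, Real.norm_eq_abs, inv_mul_lt_iff₀ hne']
  refine hq.trans_lt ?_
  rw [h4]
  have h5 : ε / (2 * (C + 1)) * (|q.2.2 - q.2.1| * ‖dq u q‖) ≤
      |q.2.2 - q.2.1| * (ε / (2 * (C + 1)) * (C + 1)) := by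
    rw [mul_left_comm]
    gcongr
    linarith [hC q]
  refine h5.trans_lt ?_
  have h6 : ε / (2 * (C + 1)) * (C + 1) = ε / 2 := by field_simp
  rw [h6]
  exact mul_lt_mul_of_pos_left (by linarith) hne'

lemma OscLE.comp_strict {G : E → ℝ} {G' : E →L[ℝ] ℝ} {u : ℝ → ℝ → E} {t x C L c : ℝ}
    (h : OscLE u t x c) (hG : HasStrictFDerivAt G G' (u t x))
    (hu : Continuous fun p : ℝ × ℝ => u p.1 p.2) (hC : ∀ q, ‖dq u q‖ ≤ C)
    (hL : 0 ≤ L) (hG' : ∀ z, |G' z| ≤ L * ‖z‖) :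
    OscLE (fun t x => G (u t x)) t x (L * c) := by
  intro d hd
  set η := (d - L * c) / 4 with hη
  have hη0 : 0 < η := by rw [hη]; linarith
  have h1 := (tendsto_dq_comp_sub hG hu hC).norm.eventually
    (ge_mem_nhds (by rwa [norm_zero] : ‖(0 : ℝ)‖ < η))
  have h2 := h (c + η / (L + 1)) (by have : 0 < η / (L + 1) := by positivity
                                     linarith)
  filter_upwards [h2, tendsto_fst.eventually h1, tendsto_snd.eventually h1] with r h3 h4 h5
  have h6 : dq (fun t x => G (u t x)) r.1 - dq (fun t x => G (u t x)) r.2 =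
      (dq (fun t x => G (u t x)) r.1 - G' (dq u r.1)) -
      (dq (fun t x => G (u t x)) r.2 - G' (dq u r.2)) + G' (dq u r.1 - dq u r.2) := by
    rw [map_sub]; ring
  have h7 : |G' (dq u r.1 - dq u r.2)| ≤ L * (c + η / (L + 1)) :=
    (hG' _).trans (mul_le_mul_of_nonneg_left h3 hL)
  have h8 : L * (η / (L + 1)) ≤ η := by
    rw [mul_div_assoc', div_le_iff₀ (by positivity)]; nlinarith
  rw [h6]
  refine (norm_add_le _ _).trans ?_
  have h9 := norm_sub_le (dq (fun t x => G (u t x)) r.1 - G' (dq u r.1))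
    (dq (fun t x => G (u t x)) r.2 - G' (dq u r.2))
  rw [Real.norm_eq_abs (G' _)]
  linarith

lemma eventually_integral_le {α : Type*} {F : Filter α} [F.IsCountablyGenerated]
    {h : α → ℝ → ℝ} {c : ℝ → ℝ} {a b C : ℝ} (hab : a ≤ b)
    (hcont : ∀ r, Continuous (h r)) (hc : Continuous c)
    (hC : ∀ r, ∀ σ ∈ Icc a b, |h r σ| ≤ C)
    (hle : ∀ σ ∈ Icc a b, ∀ c' > c σ, ∀ᶠ r in F, h r σ ≤ c') {d : ℝ}
    (hd : ∫ σ in a..b, c σ < d) : ∀ᶠ r in F, ∫ σ in a..b, h r σ ≤ d := by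
  have h1 : Tendsto (fun r => ∫ σ in a..b, max (h r σ - c σ) 0) F
      (𝓝 (∫ σ in a..b, (0 : ℝ))) := by
    refine intervalIntegral.tendsto_integral_filter_of_dominated_convergence
      (fun σ => C + |c σ|) ?_ ?_ ?_ ?_
    · exact Eventually.of_forall fun r => (by fun_prop :
        Continuous fun σ => max (h r σ - c σ) 0).aestronglyMeasurable
    · refine Eventually.of_forall fun r => Eventually.of_forall fun σ hσ => ?_
      rw [uIoc_of_le hab] at hσ
      have h2 := hC r σ ⟨hσ.1.le, hσ.2⟩
      rw [Real.norm_of_nonneg (le_max_right _ _)]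
      refine max_le ?_ ((abs_nonneg _).trans (h2.trans (by linarith [abs_nonneg (c σ)])))
      linarith [le_abs_self (h r σ), neg_abs_le (c σ)]
    · exact Continuous.intervalIntegrable (by fun_prop) _ _
    · refine Eventually.of_forall fun σ hσ => ?_
      rw [uIoc_of_le hab] at hσ
      rw [Metric.tendsto_nhds]
      intro ε hε
      filter_upwards [hle σ ⟨hσ.1.le, hσ.2⟩ (c σ + ε / 2) (by linarith)] with r hr
      rw [dist_zero_right, Real.norm_of_nonneg (le_max_right _ _)]
      exact max_lt (by linarith) hε
  rw [intervalIntegral.integral_zero] at h1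
  filter_upwards [h1.eventually (ge_mem_nhds (sub_pos.2 hd))] with r hr
  have hcr := hcont r
  have h3 : ∫ σ in a..b, h r σ ≤ ∫ σ in a..b, (c σ + max (h r σ - c σ) 0) := by
    refine intervalIntegral.integral_mono_on hab (hcr.intervalIntegrable _ _)
      (Continuous.intervalIntegrable (by fun_prop) _ _) fun σ _ => ?_
    linarith [le_max_left (h r σ - c σ) 0]
  rw [intervalIntegral.integral_add (hc.intervalIntegrable _ _)
    (Continuous.intervalIntegrable (by fun_prop) _ _)] at h3
  linarith

lemma dq_integral {h : ℝ → ℝ → ℝ → ℝ} (hcont : ∀ t x, Continuous fun σ => h σ t x)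
    (α β : ℝ → ℝ) (q : ℝ × ℝ × ℝ) :
    dq (fun t x => ∫ σ in α t..β t, h σ t x) q = ∫ σ in α q.1..β q.1, dq (h σ) q := by
  simp only [dq]
  rw [intervalIntegral.integral_smul, intervalIntegral.integral_sub
    ((hcont _ _).intervalIntegrable _ _) ((hcont _ _).intervalIntegrable _ _)]

lemma abs_integral_sub_integral_le {f : ℝ → ℝ} (hf : Continuous f) {T C a b a' b' : ℝ}
    (hC : ∀ σ ∈ Icc 0 T, |f σ| ≤ C) (ha : a ∈ Icc 0 T) (hb : b ∈ Icc 0 T) (ha' : a' ∈ Icc 0 T)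
    (hb' : b' ∈ Icc 0 T) :
    |(∫ σ in a'..b', f σ) - ∫ σ in a..b, f σ| ≤ C * |b - b'| + C * |a - a'| := by
  have hpiece : ∀ a ∈ Icc 0 T, ∀ b ∈ Icc 0 T, |∫ σ in a..b, f σ| ≤ C * |b - a| := by
    intro a ha b hb
    have h1 := intervalIntegral.norm_integral_le_of_norm_le_const (a := a) (b := b) (C := C)
      (f := f) fun σ hσ => hC σ ((uIcc_subset_Icc ha hb) (uIoc_subset_uIcc hσ))
    exact h1
  have e1 := intervalIntegral.integral_add_adjacent_intervals
    (hf.intervalIntegrable a a') (hf.intervalIntegrable (μ := volume) a' b')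
  have e2 := intervalIntegral.integral_add_adjacent_intervals
    (hf.intervalIntegrable a b') (hf.intervalIntegrable (μ := volume) b' b)
  have b1 := hpiece a ha a' ha'
  have b2 := hpiece b' hb' b hb
  rw [abs_sub_comm a'] at b1
  have c1 := abs_le.1 b1
  have c2 := abs_le.1 b2
  exact abs_le.2 ⟨by linarith [c1.1, c1.2, c2.1, c2.2], by linarith [c1.1, c1.2, c2.1, c2.2]⟩

lemma OscLE.integral {h : ℝ → ℝ → ℝ → ℝ} {c α β : ℝ → ℝ} {T C t x : ℝ}
    (hcont : ∀ t x, Continuous fun σ => h σ t x) (hc : Continuous c)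
    (hα : Continuous α) (hβ : Continuous β) (hα0 : ∀ t, 0 ≤ α t) (hαβ : ∀ t, α t ≤ β t)
    (hβT : ∀ t, β t ≤ T) (hC : ∀ σ ∈ Icc 0 T, ∀ q, |dq (h σ) q| ≤ C)
    (hosc : ∀ σ ∈ Icc 0 T, OscLE (h σ) t x (c σ)) :
    OscLE (fun t x => ∫ σ in α t..β t, h σ t x) t x (∫ σ in α t..β t, c σ) := by
  have hdqc : ∀ q, Continuous fun σ => dq (h σ) q := by
    intro q
    have h1 := hcont q.1 q.2.2
    have h2 := hcont q.1 q.2.1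
    simp only [dq]
    fun_prop
  have hdq_int : ∀ q a b, IntervalIntegrable (fun σ => dq (h σ) q) volume a b :=
    fun q a b => (hdqc q).intervalIntegrable a b
  have hαm : ∀ t, α t ∈ Icc 0 T := fun t => ⟨hα0 t, (hαβ t).trans (hβT t)⟩
  have hβm : ∀ t, β t ∈ Icc 0 T := fun t => ⟨(hα0 t).trans (hαβ t), hβT t⟩
  intro d hd
  have herr : Tendsto (fun q : ℝ × ℝ × ℝ => C * |β t - β q.1| + C * |α t - α q.1|)
      (offDiag t x) (𝓝 0) := by
    have h1 : Continuous fun q : ℝ × ℝ × ℝ => C * |β t - β q.1| + C * |α t - α q.1| := by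
      fun_prop
    have h2 := (h1.tendsto (t, x, x)).mono_left (offDiag_le t x)
    simpa using h2
  generalize hI : ∫ σ in α t..β t, c σ = I at hd
  have herr' := herr.eventually (ge_mem_nhds (show 0 < (d - I) / 4 by linarith))
  have hmain : ∀ᶠ r in offDiag t x ×ˢ offDiag t x,
      ∫ σ in α t..β t, |dq (h σ) r.1 - dq (h σ) r.2| ≤ I + (d - I) / 2 := by
    have hI' : ∫ σ in α t..β t, c σ < I + (d - I) / 2 := by rw [hI]; linarith
    have hcg : (offDiag t x ×ˢ offDiag t x).IsCountablyGenerated := inferInstance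
    have hcc : ∀ r : (ℝ × ℝ × ℝ) × (ℝ × ℝ × ℝ),
        Continuous fun σ => |dq (h σ) r.1 - dq (h σ) r.2| :=
      fun r => ((hdqc r.1).sub (hdqc r.2)).abs
    refine eventually_integral_le (C := C + C) (hαβ t) hcc hc ?_ ?_ hI'
    · intro r σ hσ
      have hσ' : σ ∈ Icc 0 T := ⟨(hα0 t).trans hσ.1, hσ.2.trans (hβT t)⟩
      rw [abs_abs]
      exact (abs_sub _ _).trans (add_le_add (hC σ hσ' _) (hC σ hσ' _))
    · intro σ hσ c' hc'
      exact hosc σ ⟨(hα0 t).trans hσ.1, hσ.2.trans (hβT t)⟩ c' hc'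
  filter_upwards [hmain, tendsto_fst.eventually herr', tendsto_snd.eventually herr']
    with r h1 h2 h3
  have hsplit := fun q : ℝ × ℝ × ℝ => abs_integral_sub_integral_le (hdqc q)
    (fun σ hσ => hC σ hσ q) (hαm t) (hβm t) (hαm q.1) (hβm q.1)
  have hdiff : |(∫ σ in α t..β t, dq (h σ) r.1) - ∫ σ in α t..β t, dq (h σ) r.2| ≤
      I + (d - I) / 2 := by
    rw [← intervalIntegral.integral_sub (hdq_int _ _ _) (hdq_int _ _ _)]
    exact (intervalIntegral.abs_integral_le_integral_abs (hαβ t)).trans h1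
  have s1 := abs_le.1 ((hsplit r.1).trans h2)
  have s2 := abs_le.1 ((hsplit r.2).trans h3)
  have s3 := abs_le.1 hdiff
  rw [dq_integral hcont, dq_integral hcont, Real.norm_eq_abs]
  exact abs_le.2 ⟨by linarith [s1.1, s1.2, s2.1, s2.2, s3.1, s3.2],
    by linarith [s1.1, s1.2, s2.1, s2.2, s3.1, s3.2]⟩

end Oscillation

namespace TransportData
variable {ι : Type*} [Fintype ι] {S : TransportData ι}

namespace IsMildSolution

variable {w : ℝ → ℝ → ι → ℝ} {X : ι → ℝ → ℝ → ℝ → ℝ}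

lemma continuous_along (hs : S.IsMildSolution w X) (i : ι) (t x : ℝ) :
    Continuous fun σ => w σ (X i σ t x) :=
  hs.continuous_w.comp (continuous_id.prodMk
    ((hs.continuous_X i).comp (by fun_prop : Continuous fun σ : ℝ => (σ, t, x))))

lemma X_eq_self (hs : S.IsMildSolution w X) (i : ι) {τ t : ℝ} (h : S.clamp t ≤ S.clamp τ)
    (x : ℝ) : X i τ t x = x := by
  rw [hs.eq_X, shiftStep, min_eq_right h, intervalIntegral.integral_same, sub_zero]

lemma X_eq (hs : S.IsMildSolution w X) (i : ι) {τ t : ℝ} (h0 : 0 ≤ τ) (hτ : τ ≤ t)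
    (hT : t ≤ S.T) (x : ℝ) :
    X i τ t x = x - ∫ σ in τ..t, S.speed i (w σ (X i σ t x)) := by
  rw [hs.eq_X, shiftStep, S.clamp_eq h0 (hτ.trans hT), S.clamp_eq (h0.trans hτ) hT, min_eq_left hτ]

lemma X_trans (hs : S.IsMildSolution w X) (i : ι) {τ t₁ t₂ : ℝ} (h0 : 0 ≤ τ) (h1 : τ ≤ t₁)
    (h2 : t₁ ≤ t₂) (hT : t₂ ≤ S.T) (x : ℝ) : X i τ t₁ (X i t₁ t₂ x) = X i τ t₂ x := by
  obtain ⟨y, hy⟩ : ∃ y, y = X i t₁ t₂ x := ⟨_, rfl⟩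
  rw [← hy]
  have hc : ∀ t x, Continuous fun σ => X i σ t x := fun t x =>
    (hs.continuous_X i).comp (by fun_prop : Continuous fun σ : ℝ => (σ, t, x))
  have hsp : ∀ t x, Continuous fun σ => S.speed i (w σ (X i σ t x)) := fun t x =>
    (S.continuous_speed i).comp (hs.continuous_along i t x)
  obtain ⟨m, ⟨hm0, hm1⟩, hm⟩ := isCompact_Icc.exists_isMaxOn (nonempty_Icc.2 (h0.trans h1))
    (f := fun σ => |X i σ t₁ y - X i σ t₂ x|)
    ((hc t₁ y).sub (hc t₂ x)).abs.continuousOn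
  have key : |X i m t₁ y - X i m t₂ x| ≤
      S.T * S.L * S.W * (4 * S.K * |X i m t₁ y - X i m t₂ x|) := by
    have e1 := hs.X_eq i hm0 hm1 (h2.trans hT) y
    have e2 := hs.X_eq i hm0 (hm1.trans h2) hT x
    have e3 := hs.X_eq i (hm0.trans hm1) h2 hT x
    have e4 := intervalIntegral.integral_add_adjacent_intervals
      ((hsp t₂ x).intervalIntegrable (μ := volume) m t₁)
      ((hsp t₂ x).intervalIntegrable (μ := volume) t₁ t₂)
    have e5 : X i m t₁ y - X i m t₂ x = -((∫ σ in m..t₁, S.speed i (w σ (X i σ t₁ y))) -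
        ∫ σ in m..t₁, S.speed i (w σ (X i σ t₂ x))) := by
      rw [e1, e2, ← e4, hy, e3]; ring
    have hK := S.K_pos
    have h6 := S.abs_integral_speed_sub_le i (hs.continuous_along i t₁ y)
      (hs.continuous_along i t₂ x) hm0 hm1 (h2.trans hT)
      (δ := 4 * S.K * |X i m t₁ y - X i m t₂ x|) (by positivity) ?_
    · rw [← abs_neg, ← e5] at h6
      exact h6
    · intro σ hσ0 hσ1
      have hσ := hs.lipschitz_w σ (X i σ t₁ y) (X i σ t₂ x)
      have hσm : |X i σ t₁ y - X i σ t₂ x| ≤ |X i m t₁ y - X i m t₂ x| := hm ⟨hm0.trans hσ0, hσ1⟩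
      rw [S.clamp_eq (hm0.trans hσ0) (hσ1.trans (h2.trans hT))] at hσ
      have hw0 := S.one_le_weight σ (hm0.trans hσ0)
      refine hσ.trans ?_
      gcongr
  have hle : |X i τ t₁ y - X i τ t₂ x| ≤ |X i m t₁ y - X i m t₂ x| := hm ⟨h0, h1⟩
  have hz : |X i m t₁ y - X i m t₂ x| ≤ 0 := by
    nlinarith [S.small, abs_nonneg (X i m t₁ y - X i m t₂ x)]
  exact sub_eq_zero.1 (abs_nonpos_iff.1 (hle.trans hz))

lemma w_eq_add_integral (hs : S.IsMildSolution w X) (i : ι) {t₁ t₂ : ℝ} (h1 : 0 ≤ t₁)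
    (h2 : t₁ ≤ t₂) (hT : t₂ ≤ S.T) (x : ℝ) :
    w t₂ x i = w t₁ (X i t₁ t₂ x) i +
      ∫ σ in t₁..t₂, S.coeff σ * S.source i (w σ (X i σ t₂ x)) := by
  have hc : Continuous fun σ => S.coeff σ * S.source i (w σ (X i σ t₂ x)) :=
    S.continuous_coeff.mul ((S.source i).continuous.comp (hs.continuous_along i t₂ x))
  rw [hs.eq_w, hs.eq_w, wStep, wStep, S.clamp_eq (h1.trans h2) hT, S.clamp_eq h1 (h2.trans hT),
    hs.X_trans i le_rfl h1 h2 hT, ← intervalIntegral.integral_add_adjacent_intervals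
      (hc.intervalIntegrable 0 t₁) (hc.intervalIntegrable t₁ t₂), add_assoc]
  congr 2
  refine intervalIntegral.integral_congr fun σ hσ => ?_
  rw [uIcc_of_le h1] at hσ
  simp only [hs.X_trans i hσ.1 hσ.2 h2 hT]

end IsMildSolution

lemma weight_clamp_le (S : TransportData ι) (t : ℝ) : S.weight (S.clamp t) ≤ S.W :=
  S.weight_le _ (S.clamp_nonneg t) (S.clamp_le t)

/-- The difference quotients of `w` and of the characteristics oscillate at most by `e`, in the
units relevant for the contraction. -/
def OscBound (S : TransportData ι) (w : ℝ → ℝ → ι → ℝ) (X : ι → ℝ → ℝ → ℝ → ℝ) (e : ℝ) : Prop :=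
  (∀ t x, OscLE w t x (e * S.weight (S.clamp t))) ∧
    ∀ i τ t x, OscLE (X i τ) t x (e / (8 * S.K))

namespace IsMildSolution

variable {w : ℝ → ℝ → ι → ℝ} {X : ι → ℝ → ℝ → ℝ → ℝ}

lemma norm_dq_w_le (hs : S.IsMildSolution w X) (q : ℝ × ℝ × ℝ) :
    ‖dq w q‖ ≤ S.weight (S.clamp q.1) * (4 * S.K) := by
  have hK := S.K_pos
  have hw := S.weight_clamp_pos q.1
  rcases eq_or_ne q.2.2 q.2.1 with h | h
  · simp only [dq, h, sub_self, smul_zero, norm_zero]; positivity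
  · have h0 : 0 < |q.2.2 - q.2.1| := abs_pos.2 (sub_ne_zero.2 h)
    rw [dq, norm_smul, norm_inv, Real.norm_eq_abs, inv_mul_le_iff₀ h0]
    refine (hs.lipschitz_w _ _ _).trans (le_of_eq ?_)
    ring

lemma abs_dq_X_sub_one_le (hs : S.IsMildSolution w X) (i : ι) (τ : ℝ) {q : ℝ × ℝ × ℝ}
    (h : q.2.1 ≠ q.2.2) : |dq (X i τ) q - 1| ≤ 1 / 2 := by
  have h0 : q.2.2 - q.2.1 ≠ 0 := sub_ne_zero.2 h.symm
  have h1 : dq (X i τ) q - 1 = (q.2.2 - q.2.1)⁻¹ *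
      ((X i τ q.1 q.2.2 - X i τ q.1 q.2.1) - (q.2.2 - q.2.1)) := by
    rw [dq, smul_eq_mul]; field_simp
  rw [h1, abs_mul, abs_inv, inv_mul_le_iff₀ (abs_pos.2 h0)]
  linarith [hs.lipschitz_X i τ q.1 q.2.2 q.2.1]

lemma abs_dq_X_le (hs : S.IsMildSolution w X) (i : ι) (τ : ℝ) (q : ℝ × ℝ × ℝ) :
    |dq (X i τ) q| ≤ 3 / 2 := by
  rcases eq_or_ne q.2.1 q.2.2 with h | h
  · simp only [dq, h, sub_self, smul_zero, abs_zero]; norm_num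
  · have := abs_le.1 (hs.abs_dq_X_sub_one_le i τ h)
    exact abs_le.2 ⟨by linarith [this.1], by linarith [this.2]⟩

lemma X_ne (hs : S.IsMildSolution w X) (i : ι) (τ t : ℝ) {x y : ℝ} (h : x ≠ y) :
    X i τ t x ≠ X i τ t y := by
  intro he
  have h1 := hs.lipschitz_X i τ t x y
  have h2 := abs_pos.2 (sub_ne_zero.2 h)
  rw [he, sub_self, zero_sub, abs_neg] at h1
  linarith

lemma tendsto_flow (hs : S.IsMildSolution w X) (i : ι) (σ t x : ℝ) :
    Tendsto (fun q : ℝ × ℝ × ℝ => (σ, X i σ q.1 q.2.1, X i σ q.1 q.2.2)) (offDiag t x)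
      (offDiag σ (X i σ t x)) := by
  have hX := hs.continuous_X i
  refine tendsto_nhdsWithin_iff.2 ⟨?_, ?_⟩
  · have hc : Continuous fun q : ℝ × ℝ × ℝ => (σ, X i σ q.1 q.2.1, X i σ q.1 q.2.2) :=
      continuous_const.prodMk ((hX.comp (by fun_prop :
        Continuous fun q : ℝ × ℝ × ℝ => (σ, q.1, q.2.1))).prodMk
        (hX.comp (by fun_prop : Continuous fun q : ℝ × ℝ × ℝ => (σ, q.1, q.2.2))))
    exact (hc.tendsto (t, x, x)).mono_left (offDiag_le t x)
  · filter_upwards [eventually_offDiag_ne t x] with q hq using hs.X_ne i σ q.1 hq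

lemma dq_along (hs : S.IsMildSolution w X) (i : ι) (σ : ℝ) (q : ℝ × ℝ × ℝ) :
    dq (fun t x => w σ (X i σ t x)) q =
      dq (X i σ) q • dq w (σ, X i σ q.1 q.2.1, X i σ q.1 q.2.2) := by
  rcases eq_or_ne q.2.1 q.2.2 with h | h
  · simp [dq, h]
  · have h1 : X i σ q.1 q.2.2 - X i σ q.1 q.2.1 ≠ 0 := sub_ne_zero.2 (hs.X_ne i σ q.1 h.symm)
    simp only [dq, smul_eq_mul, smul_smul]
    rw [mul_assoc, mul_inv_cancel₀ h1, mul_one]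

lemma norm_dq_along_le (hs : S.IsMildSolution w X) (i : ι) (σ : ℝ) (q : ℝ × ℝ × ℝ) :
    ‖dq (fun t x => w σ (X i σ t x)) q‖ ≤ 3 / 2 * (S.W * (4 * S.K)) := by
  have hK := S.K_pos
  have hW := S.one_le_W
  have := S.weight_clamp_le σ
  rw [hs.dq_along, norm_smul]
  refine mul_le_mul (hs.abs_dq_X_le i σ q) ?_ (norm_nonneg _) (by norm_num)
  refine (hs.norm_dq_w_le _).trans ?_
  gcongr

lemma oscLE_along (hs : S.IsMildSolution w X) {e : ℝ} (he : S.OscBound w X e) (i : ι)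
    (σ t x : ℝ) :
    OscLE (fun t x => w σ (X i σ t x)) t x (S.weight (S.clamp σ) * (2 * e)) := by
  intro d hd
  have hK := S.K_pos
  obtain ⟨ω, hω⟩ : ∃ ω, ω = S.weight (S.clamp σ) := ⟨_, rfl⟩
  have hω0 : 0 < ω := hω ▸ S.weight_clamp_pos σ
  rw [← hω] at hd
  obtain ⟨η, hη⟩ : ∃ η, η = (d - ω * (2 * e)) / 3 := ⟨_, rfl⟩
  have hη0 : 0 < η := by rw [hη]; linarith
  have h1 := (he.1 σ (X i σ t x)) (e * ω + η) (by rw [hω]; linarith)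
  have h2 := (he.2 i σ t x) (e / (8 * S.K) + η / (4 * S.K * ω))
    (by have : 0 < η / (4 * S.K * ω) := by positivity
        linarith)
  have hΦ := hs.tendsto_flow i σ t x
  have h3 := (hΦ.prodMap hΦ).eventually h1
  filter_upwards [h2, h3] with r h4 h5
  simp only [Prod.map_fst, Prod.map_snd] at h5
  rw [hs.dq_along, hs.dq_along]
  generalize hA : dq w (σ, X i σ r.1.1 r.1.2.1, X i σ r.1.1 r.1.2.2) = A at *
  generalize dq w (σ, X i σ r.2.1 r.2.2.1, X i σ r.2.1 r.2.2.2) = A' at *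
  have h6 : ‖A‖ ≤ ω * (4 * S.K) := by rw [← hA, hω]; exact hs.norm_dq_w_le _
  have h7 := hs.abs_dq_X_le i σ r.2
  have h8 : dq (X i σ) r.1 • A - dq (X i σ) r.2 • A' =
      (dq (X i σ) r.1 - dq (X i σ) r.2) • A + dq (X i σ) r.2 • (A - A') := by
    rw [sub_smul, smul_sub]; abel
  rw [h8]
  refine (norm_add_le _ _).trans ?_
  rw [norm_smul, norm_smul]
  have h9 : ‖dq (X i σ) r.1 - dq (X i σ) r.2‖ * ‖A‖ ≤
      (e / (8 * S.K) + η / (4 * S.K * ω)) * (ω * (4 * S.K)) :=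
    mul_le_mul h4 h6 (norm_nonneg _) ((norm_nonneg _).trans h4)
  have h10 : ‖dq (X i σ) r.2‖ * ‖A - A'‖ ≤ 3 / 2 * (e * ω + η) :=
    mul_le_mul h7 h5 (norm_nonneg _) (by norm_num)
  have h11 : (e / (8 * S.K) + η / (4 * S.K * ω)) * (ω * (4 * S.K)) = e * ω / 2 + η := by
    field_simp; ring
  rw [h11] at h9
  linarith

end IsMildSolution

end TransportData

lemma oscLE_pi {ι : Type*} [Fintype ι] {u : ℝ → ℝ → ι → ℝ} {t x c : ℝ} (hc : 0 ≤ c)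
    (h : ∀ i, OscLE (fun t x => u t x i) t x c) : OscLE u t x c := by
  intro d hd
  filter_upwards [eventually_all.2 fun i => h i d hd] with r hr
  refine (pi_norm_le_iff_of_nonneg (hc.trans hd.le)).2 fun i => ?_
  exact hr i

lemma oscLE_id (t x : ℝ) : OscLE (fun _ y => y) t x 0 := by
  refine oscLE_of_tendsto (m := 1) (tendsto_const_nhds.congr' ?_)
  filter_upwards [eventually_offDiag_ne t x] with q hq
  simp [dq, inv_mul_cancel₀ (sub_ne_zero.2 hq.symm)]

lemma norm_dq_comp_le {E : Type*} [NormedAddCommGroup E] [NormedSpace ℝ E] {G : E → ℝ}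
    {u : ℝ → ℝ → E} {L C : ℝ} (hL : 0 ≤ L) (hG : ∀ v v', |G v - G v'| ≤ L * ‖v - v'‖)
    (q : ℝ × ℝ × ℝ) (hC : ‖dq u q‖ ≤ C) : |dq (fun t x => G (u t x)) q| ≤ L * C := by
  have h1 : |dq (fun t x => G (u t x)) q| ≤ L * ‖dq u q‖ := by
    rw [dq, dq, smul_eq_mul, abs_mul, norm_smul, Real.norm_eq_abs, mul_left_comm]
    exact mul_le_mul_of_nonneg_left (hG _ _) (abs_nonneg _)
  exact h1.trans (mul_le_mul_of_nonneg_left hC hL)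

namespace TransportData
variable {ι : Type*} [Fintype ι] {S : TransportData ι}

lemma hasStrictFDerivAt_speed (S : TransportData ι) (i : ι) (v : ι → ℝ) :
    HasStrictFDerivAt (S.speed i) (fderiv ℝ (S.speed i) v) v :=
  (S.contDiff_speed i).contDiffAt.hasStrictFDerivAt one_ne_zero

lemma abs_fderiv_speed_le (S : TransportData ι) (i : ι) (v z : ι → ℝ) :
    |fderiv ℝ (S.speed i) v z| ≤ S.L * ‖z‖ := by
  have h1 : ‖fderiv ℝ (S.speed i) v‖ ≤ S.L :=
    (S.hasStrictFDerivAt_speed i v).hasFDerivAt.le_of_lip' S.L_nonneg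
      (Eventually.of_forall fun v' => S.speed_lipschitz i v' v)
  exact ((fderiv ℝ (S.speed i) v).le_opNorm z).trans
    (mul_le_mul_of_nonneg_right h1 (norm_nonneg _))

lemma hasStrictFDerivAt_initial (S : TransportData ι) (i : ι) (x : ℝ) :
    HasStrictFDerivAt (S.initial i) (fderiv ℝ (S.initial i) x) x :=
  (S.contDiff_initial i).contDiffAt.hasStrictFDerivAt one_ne_zero

lemma abs_fderiv_initial_le (S : TransportData ι) (i : ι) (x z : ℝ) :
    |fderiv ℝ (S.initial i) x z| ≤ S.K * ‖z‖ := by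
  have h1 : ‖fderiv ℝ (S.initial i) x‖ ≤ S.K :=
    (S.hasStrictFDerivAt_initial i x).hasFDerivAt.le_of_lip' S.K_pos.le
      (Eventually.of_forall fun v' => S.initial_lipschitz i v' x)
  exact ((fderiv ℝ (S.initial i) x).le_opNorm z).trans
    (mul_le_mul_of_nonneg_right h1 (norm_nonneg _))

namespace IsMildSolution

variable {w : ℝ → ℝ → ι → ℝ} {X : ι → ℝ → ℝ → ℝ → ℝ}

lemma continuous_slice (hs : S.IsMildSolution w X) (i : ι) (σ : ℝ) :
    Continuous fun p : ℝ × ℝ => X i σ p.1 p.2 :=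
  (hs.continuous_X i).comp (by fun_prop : Continuous fun p : ℝ × ℝ => (σ, p.1, p.2))

lemma continuous_w_slice (hs : S.IsMildSolution w X) (i : ι) (σ : ℝ) :
    Continuous fun p : ℝ × ℝ => w σ (X i σ p.1 p.2) :=
  hs.continuous_w.comp (continuous_const.prodMk (hs.continuous_slice i σ))

lemma oscLE_shiftStep (hs : S.IsMildSolution w X) {e : ℝ} (he0 : 0 ≤ e) (he : S.OscBound w X e)
    (i : ι) (τ t x : ℝ) : OscLE (S.shiftStep w X i τ) t x (e / (16 * S.K)) := by
  have hL := S.L_nonneg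
  have hK := S.K_pos
  have hW := S.one_le_W
  have h1 := OscLE.integral (h := fun σ t x => S.speed i (w σ (X i σ t x)))
    (c := fun σ => S.L * (S.weight (S.clamp σ) * (2 * e)))
    (α := fun t => min (S.clamp τ) (S.clamp t)) (β := S.clamp) (T := S.T)
    (C := S.L * (3 / 2 * (S.W * (4 * S.K)))) (t := t) (x := x)
    (fun t x => (S.continuous_speed i).comp (hs.continuous_along i t x)) (by fun_prop)
    (by fun_prop) (by fun_prop) (fun t => le_min (S.clamp_nonneg _) (S.clamp_nonneg _))
    (fun t => min_le_right _ _) S.clamp_le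
    (fun σ _ q => norm_dq_comp_le hL (S.speed_lipschitz i) q (hs.norm_dq_along_le i σ q))
    (fun σ _ => (hs.oscLE_along he i σ t x).comp_strict (S.hasStrictFDerivAt_speed i _)
      (hs.continuous_w_slice i σ) (hs.norm_dq_along_le i σ) hL (S.abs_fderiv_speed_le i _))
  refine OscLE.mono h1 ?_
  have h2 := intervalIntegral.norm_integral_le_of_norm_le_const
    (a := min (S.clamp τ) (S.clamp t)) (b := S.clamp t) (C := S.L * (S.W * (2 * e)))
    (f := fun σ => S.L * (S.weight (S.clamp σ) * (2 * e))) fun σ _ => by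
      have := S.weight_clamp_pos σ
      rw [Real.norm_of_nonneg (by positivity)]
      have := S.weight_clamp_le σ
      gcongr
  have h3 : |S.clamp t - min (S.clamp τ) (S.clamp t)| ≤ S.T := by
    have h4 : 0 ≤ min (S.clamp τ) (S.clamp t) := le_min (S.clamp_nonneg _) (S.clamp_nonneg _)
    rw [abs_of_nonneg (sub_nonneg.2 (min_le_right _ _))]
    linarith [S.clamp_le t]
  have h5 : S.L * (S.W * (2 * e)) * S.T ≤ e / (16 * S.K) := by
    rw [le_div_iff₀ (by positivity)]
    nlinarith [S.small]
  exact (le_abs_self _).trans (h2.trans ((mul_le_mul_of_nonneg_left h3 (by positivity)).trans h5))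

lemma oscLE_integral_source (hs : S.IsMildSolution w X) {e : ℝ} (he : S.OscBound w X e)
    (i : ι) (t x : ℝ) :
    OscLE (fun t x => ∫ τ in (0 : ℝ)..S.clamp t, S.coeff τ * S.source i (w τ (X i τ t x))) t x
      ((S.weight (S.clamp t) - 1) * e / 2) := by
  obtain ⟨A, hA⟩ := (isCompact_Icc (a := (0 : ℝ)) (b := S.T)).exists_bound_of_continuousOn
    S.continuous_coeff.continuousOn
  have hlip : ∀ σ v v', |S.coeff σ * S.source i v - S.coeff σ * S.source i v'| ≤
      S.coeff σ * ‖v - v'‖ := by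
    intro σ v v'
    rw [← mul_sub, ← map_sub, abs_mul, abs_of_nonneg (S.coeff_nonneg σ)]
    exact mul_le_mul_of_nonneg_left (S.source_le i _) (S.coeff_nonneg σ)
  have hK := S.K_pos
  have hW := S.one_le_W
  have h1 := OscLE.integral (h := fun σ t x => S.coeff σ * S.source i (w σ (X i σ t x)))
    (c := fun σ => S.coeff σ * (S.weight (S.clamp σ) * (2 * e)))
    (α := fun _ => 0) (β := S.clamp) (T := S.T)
    (C := A * (3 / 2 * (S.W * (4 * S.K)))) (t := t) (x := x)
    (fun t x => S.continuous_coeff.mul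
      ((S.source i).continuous.comp (hs.continuous_along i t x))) (by fun_prop)
    continuous_const (by fun_prop) (fun _ => le_rfl) S.clamp_nonneg S.clamp_le
    (fun σ hσ q => (norm_dq_comp_le (G := fun v => S.coeff σ * S.source i v) (S.coeff_nonneg σ)
      (hlip σ) q (hs.norm_dq_along_le i σ q)).trans (mul_le_mul_of_nonneg_right
        ((le_abs_self _).trans (hA σ hσ)) (by positivity)))
    (fun σ _ => (hs.oscLE_along he i σ t x).comp_strict (G := fun v => S.coeff σ * S.source i v)
      (G' := S.coeff σ • S.source i)
      ((S.coeff σ • S.source i).hasStrictFDerivAt)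
      (hs.continuous_w_slice i σ) (hs.norm_dq_along_le i σ) (S.coeff_nonneg σ) (by
        intro z
        have := hlip σ z 0
        simpa using this))
  refine h1.mono (le_of_eq ?_)
  have h2 : ∫ σ in (0 : ℝ)..S.clamp t, S.coeff σ * (S.weight (S.clamp σ) * (2 * e)) =
      ∫ σ in (0 : ℝ)..S.clamp t, S.coeff σ * S.weight σ * (2 * e) := by
    refine intervalIntegral.integral_congr fun σ hσ => ?_
    rw [uIcc_of_le (S.clamp_nonneg t)] at hσ
    simp only [S.clamp_eq hσ.1 (hσ.2.trans (S.clamp_le t)), mul_assoc]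
  rw [h2, intervalIntegral.integral_mul_const, S.integral_coeff_mul_weight]
  ring

lemma oscBound_step (hs : S.IsMildSolution w X) {e : ℝ} (he0 : 0 ≤ e) (he : S.OscBound w X e) :
    S.OscBound w X (5 / 8 * e) := by
  have hK := S.K_pos
  refine ⟨fun t x => ?_, fun i τ t x => ?_⟩
  · have hω := S.one_le_weight _ (S.clamp_nonneg t)
    refine oscLE_pi (by positivity) fun i => ?_
    have h1 := (he.2 i 0 t x).comp_strict (G := S.initial i) (S.hasStrictFDerivAt_initial i _)
      (hs.continuous_slice i 0) (fun q => hs.abs_dq_X_le i 0 q) hK.le (S.abs_fderiv_initial_le i _)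
    have h2 := h1.add (hs.oscLE_integral_source he i t x)
    have h3 : (fun t x => w t x i) = fun t x => S.initial i (X i 0 t x) +
        ∫ τ in (0 : ℝ)..S.clamp t, S.coeff τ * S.source i (w τ (X i τ t x)) := by
      ext t x; exact hs.eq_w t x i
    rw [h3]
    refine h2.mono ?_
    have h4 : S.K * (e / (8 * S.K)) = e / 8 := by field_simp
    rw [h4]
    nlinarith
  · have h1 := (oscLE_id t x).add (hs.oscLE_shiftStep he0 he i τ t x).neg
    have h3 : X i τ = fun t x => x + -S.shiftStep w X i τ t x := by
      ext t x; rw [hs.eq_X, sub_eq_add_neg]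
    rw [h3]
    refine h1.mono ?_
    rw [zero_add, div_le_div_iff₀ (by positivity) (by positivity)]
    nlinarith [mul_nonneg he0 hK.le]

lemma oscBound_pow (hs : S.IsMildSolution w X) (n : ℕ) :
    S.OscBound w X ((5 / 8) ^ n * (8 * S.K)) := by
  have hK := S.K_pos
  induction n with
  | succ n ih =>
    rw [pow_succ', mul_assoc]
    exact hs.oscBound_step (by positivity) ih
  | zero =>
    rw [pow_zero, one_mul]
    refine ⟨fun t x d hd => ?_, fun i τ t x d hd => ?_⟩
    · have hc : Tendsto (fun q : ℝ × ℝ × ℝ => S.weight (S.clamp q.1) * (4 * S.K)) (offDiag t x)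
          (𝓝 (S.weight (S.clamp t) * (4 * S.K))) :=
        ((by fun_prop : Continuous fun q : ℝ × ℝ × ℝ =>
          S.weight (S.clamp q.1) * (4 * S.K)).tendsto (t, x, x)).mono_left (offDiag_le t x)
      have h1 := hc.eventually (ge_mem_nhds
        (show S.weight (S.clamp t) * (4 * S.K) < d / 2 by linarith))
      filter_upwards [tendsto_fst.eventually h1, tendsto_snd.eventually h1] with r h2 h3
      refine (norm_sub_le _ _).trans ?_
      linarith [hs.norm_dq_w_le r.1, hs.norm_dq_w_le r.2]
    · rw [div_self (by positivity)] at hd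
      have h1 := eventually_offDiag_ne t x
      filter_upwards [tendsto_fst.eventually h1, tendsto_snd.eventually h1] with r h2 h3
      have h4 := abs_le.1 (hs.abs_dq_X_sub_one_le i τ h2)
      have h5 := abs_le.1 (hs.abs_dq_X_sub_one_le i τ h3)
      exact abs_le.2 ⟨by linarith [h4.1, h4.2, h5.1, h5.2], by linarith [h4.1, h4.2, h5.1, h5.2]⟩

/-- The mild solution has a strict spatial derivative. -/
lemma exists_tendsto_dq (hs : S.IsMildSolution w X) (t x : ℝ) :
    ∃ m, Tendsto (dq w) (offDiag t x) (𝓝 m) := by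
  have h : Cauchy (map (dq w) (offDiag t x)) := by
    refine Metric.cauchy_iff.2 ⟨inferInstance, fun ε hε => ?_⟩
    have hK := S.K_pos
    have hω := S.weight_clamp_pos t
    have ht : Tendsto (fun n : ℕ => (5 / 8 : ℝ) ^ n * (8 * S.K) * S.weight (S.clamp t)) atTop
        (𝓝 0) := by
      have := ((tendsto_pow_atTop_nhds_zero_of_lt_one (r := (5 / 8 : ℝ)) (by norm_num)
        (by norm_num)).mul_const (8 * S.K)).mul_const (S.weight (S.clamp t))
      simpa using this
    obtain ⟨n, hn⟩ := (ht.eventually (gt_mem_nhds (by positivity : 0 < ε / 2))).exists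
    obtain ⟨s, hs1, hs2⟩ := eventually_prod_self_iff'.1
      ((hs.oscBound_pow n).1 t x (ε / 2) hn)
    refine ⟨dq w '' s, image_mem_map hs1, ?_⟩
    rintro _ ⟨a, ha, rfl⟩ _ ⟨b, hb, rfl⟩
    rw [dist_eq_norm]
    exact (hs2 a ha b hb).trans_lt (by linarith)
  exact CompleteSpace.complete h

end IsMildSolution
end TransportData

section StrictSlices

variable {E : Type*} [NormedAddCommGroup E] [NormedSpace ℝ E] {u p : ℝ → ℝ → E}

lemma eventually_norm_sub_smul_le {t x : ℝ} {m : E} (h : Tendsto (dq u) (offDiag t x) (𝓝 m))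
    {η : ℝ} (hη : 0 < η) : ∀ᶠ q : ℝ × ℝ × ℝ in 𝓝 (t, x, x),
      ‖u q.1 q.2.2 - u q.1 q.2.1 - (q.2.2 - q.2.1) • m‖ ≤ η * |q.2.2 - q.2.1| := by
  have h1 := eventually_nhdsWithin_iff.1 (h.eventually (Metric.closedBall_mem_nhds m hη))
  filter_upwards [h1] with q hq
  rcases eq_or_ne q.2.1 q.2.2 with he | he
  · simp [he]
  · have h2 := hq he
    have h3 : q.2.2 - q.2.1 ≠ 0 := sub_ne_zero.2 he.symm
    have h4 : u q.1 q.2.2 - u q.1 q.2.1 - (q.2.2 - q.2.1) • m =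
        (q.2.2 - q.2.1) • (dq u q - m) := by
      rw [dq, smul_sub, smul_inv_smul₀ h3]
    rw [h4, norm_smul, Real.norm_eq_abs, mul_comm]
    rw [dist_eq_norm] at h2
    gcongr

lemma hasDerivAt_of_tendsto_dq {t x : ℝ} {m : E} (h : Tendsto (dq u) (offDiag t x) (𝓝 m)) :
    HasDerivAt (u t) m x := by
  rw [hasDerivAt_iff_isLittleO, Asymptotics.isLittleO_iff]
  intro c hc
  exact ((by fun_prop : Continuous fun y : ℝ => (t, x, y)).tendsto x).eventually
    (eventually_norm_sub_smul_le h hc)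

lemma continuous_of_tendsto_dq (h : ∀ t x, Tendsto (dq u) (offDiag t x) (𝓝 (p t x))) :
    Continuous fun z : ℝ × ℝ => p z.1 z.2 := by
  refine continuous_iff_continuousAt.2 fun z => Metric.tendsto_nhds.2 fun ε hε => ?_
  have h1 := eventually_nhdsWithin_iff.1
    ((h z.1 z.2).eventually (Metric.closedBall_mem_nhds _ (half_pos hε)))
  have h2 := ((by fun_prop : Continuous fun z : ℝ × ℝ => (z.1, z.2, z.2)).tendsto z).eventually
    (eventually_eventually_nhds.2 h1)
  filter_upwards [h2] with y hy
  have h3 : p y.1 y.2 ∈ Metric.closedBall (p z.1 z.2) (ε / 2) :=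
    Metric.isClosed_closedBall.mem_of_tendsto (h y.1 y.2) (eventually_nhdsWithin_iff.2 hy)
  exact (Metric.mem_closedBall.1 h3).trans_lt (by linarith)

end StrictSlices

lemma hasFDerivWithinAt_of_slices {u : ℝ → ℝ → ℝ} {s : Set ℝ} {t x q m : ℝ}
    (hx : Tendsto (dq u) (offDiag t x) (𝓝 m)) (ht : HasDerivWithinAt (fun τ => u τ x) q s t) :
    HasFDerivWithinAt (fun z : ℝ × ℝ => u z.1 z.2)
      (q • ContinuousLinearMap.fst ℝ ℝ ℝ + m • ContinuousLinearMap.snd ℝ ℝ ℝ)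
      (s ×ˢ univ) (t, x) := by
  rw [hasFDerivWithinAt_iff_isLittleO, Asymptotics.isLittleO_iff]
  intro c hc
  rw [hasDerivWithinAt_iff_isLittleO, Asymptotics.isLittleO_iff] at ht
  have h1 : ∀ᶠ z : ℝ × ℝ in 𝓝[s ×ˢ univ] (t, x),
      ‖u z.1 z.2 - u z.1 x - (z.2 - x) • m‖ ≤ c / 2 * |z.2 - x| :=
    (((by fun_prop : Continuous fun z : ℝ × ℝ => (z.1, x, z.2)).tendsto (t, x)).mono_left
      nhdsWithin_le_nhds).eventually (eventually_norm_sub_smul_le hx (half_pos hc))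
  have h2 : Tendsto Prod.fst (𝓝[s ×ˢ univ] (t, x)) (𝓝[s] t) :=
    tendsto_nhdsWithin_iff.2 ⟨continuous_fst.continuousAt.mono_left nhdsWithin_le_nhds,
      by filter_upwards [self_mem_nhdsWithin] with z hz using hz.1⟩
  filter_upwards [h1, h2.eventually (ht (half_pos hc))] with z h3 h4
  have h5 : |z.1 - t| ≤ ‖z - (t, x)‖ := norm_fst_le (z - (t, x))
  have h6 : |z.2 - x| ≤ ‖z - (t, x)‖ := norm_snd_le (z - (t, x))
  have h7 : u z.1 z.2 - u t x - (q • ContinuousLinearMap.fst ℝ ℝ ℝ +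
      m • ContinuousLinearMap.snd ℝ ℝ ℝ) (z - (t, x)) =
      (u z.1 z.2 - u z.1 x - (z.2 - x) • m) + (u z.1 x - u t x - (z.1 - t) • q) := by
    simp; ring
  rw [h7]
  refine (norm_add_le _ _).trans ?_
  rw [Real.norm_eq_abs (z.1 - t)] at h4
  nlinarith

lemma eventually_abs_integral_sub_le {g : ℝ × ℝ → ℝ} (hg : Continuous g) (t : ℝ) {η : ℝ}
    (hη : 0 < η) : ∀ᶠ s in 𝓝 t,
      |(∫ σ in min t s..max t s, g (σ, max t s)) - |s - t| * g (t, t)| ≤ η * |s - t| := by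
  obtain ⟨δ, hδ, h⟩ := Metric.continuousAt_iff.1 (hg.continuousAt (x := (t, t))) η hη
  filter_upwards [Metric.ball_mem_nhds t hδ] with s hs
  rw [Metric.mem_ball, Real.dist_eq] at hs
  have hmm : max t s - min t s = |s - t| := by
    rw [max_sub_min_eq_abs]
  have h1 := intervalIntegral.norm_integral_le_of_norm_le_const (a := min t s) (b := max t s)
    (C := η) (f := fun σ => g (σ, max t s) - g (t, t)) fun σ hσ => by
      rw [uIoc_of_le min_le_max] at hσ
      refine (h ?_).le
      have h2 := abs_lt.1 hs
      have h3 : |max t s - t| < δ := by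
        rcases le_total t s with h4 | h4 <;> simp [h4, hs, hδ]
      have h3' := abs_lt.1 h3
      have h5 : t - δ < min t s := by
        rcases le_total t s with h4 | h4 <;> simp [h4] <;> linarith
      rw [Prod.dist_eq, max_lt_iff]
      exact ⟨abs_lt.2 ⟨by linarith [hσ.1], by linarith [hσ.2]⟩, h3⟩
  have hgc : Continuous fun σ => g (σ, max t s) := by fun_prop
  rw [intervalIntegral.integral_sub (hgc.intervalIntegrable _ _) intervalIntegrable_const,
    intervalIntegral.integral_const, hmm, abs_abs, smul_eq_mul] at h1
  exact h1

lemma hasDerivAt_extend {f d : ℝ → ℝ} {T t : ℝ} (hd : Continuous d) (ht : t ∈ Icc 0 T)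
    (hf : HasDerivWithinAt f (d t) (Icc 0 T) t) :
    HasDerivAt (fun s => f (max 0 (min s T)) + (s - max 0 (min s T)) * d (max 0 (min s T)))
      (d t) t := by
  obtain ⟨κ, hκ⟩ : ∃ κ : ℝ → ℝ, κ = fun s => max 0 (min s T) := ⟨_, rfl⟩
  have hκc : Continuous κ := by rw [hκ]; fun_prop
  have hκt : κ t = t := by simp [hκ, ht.1, ht.2]
  have hκm : ∀ s, κ s ∈ Icc 0 T := fun s => by
    rw [hκ]; exact ⟨le_max_left _ _, max_le (ht.1.trans ht.2) (min_le_right _ _)⟩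
  have hκ1 : ∀ s, |s - κ s| ≤ |s - t| ∧ |κ s - t| ≤ |s - t| := by
    intro s
    have h0 := ht.1
    have h1 := ht.2
    rw [hκ]
    rcases le_total s T with h2 | h2
    · rcases le_total 0 s with h3 | h3
      · simp [h2, h3]
      · simp only [h2, h3, min_eq_left, max_eq_left]
        rw [abs_of_nonpos (by linarith : s - t ≤ 0), abs_of_nonpos (by linarith : s - 0 ≤ 0),
          abs_of_nonpos (by linarith : 0 - t ≤ 0)]
        constructor <;> linarith
    · simp only [h2, h0.trans h1, min_eq_right, max_eq_right]
      rw [abs_of_nonneg (by linarith : 0 ≤ s - t), abs_of_nonneg (by linarith : 0 ≤ s - T),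
        abs_of_nonneg (by linarith : 0 ≤ T - t)]
      constructor <;> linarith
  suffices h : HasDerivAt (fun s => f (κ s) + (s - κ s) * d (κ s)) (d t) t by
    rw [hκ] at h
    exact h
  rw [hasDerivWithinAt_iff_isLittleO, Asymptotics.isLittleO_iff] at hf
  rw [hasDerivAt_iff_isLittleO, Asymptotics.isLittleO_iff]
  intro c hc
  have h1 : Tendsto κ (𝓝 t) (𝓝[Icc 0 T] t) :=
    tendsto_nhdsWithin_iff.2 ⟨by simpa [hκt] using hκc.tendsto t, Eventually.of_forall hκm⟩
  have h2 : Tendsto (fun s => d (κ s)) (𝓝 t) (𝓝 (d t)) := by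
    simpa [hκt, Function.comp_def] using (hd.comp hκc).tendsto t
  filter_upwards [h1.eventually (hf (half_pos hc)),
    h2.eventually (Metric.closedBall_mem_nhds _ (half_pos hc))] with s h3 h4
  rw [Real.dist_eq] at h4
  have h5 : f (κ s) + (s - κ s) * d (κ s) - (f (κ t) + (t - κ t) * d (κ t)) - (s - t) • d t =
      (f (κ s) - f t - (κ s - t) • d t) + (s - κ s) * (d (κ s) - d t) := by
    simp only [smul_eq_mul, hκt]; ring
  have h6 : |(s - κ s) * (d (κ s) - d t)| ≤ |s - t| * (c / 2) := by
    rw [abs_mul]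
    exact mul_le_mul (hκ1 s).1 h4 (abs_nonneg _) (abs_nonneg _)
  rw [h5]
  refine (norm_add_le _ _).trans ?_
  rw [Real.norm_eq_abs (κ s - t)] at h3
  rw [Real.norm_eq_abs (_ * _), Real.norm_eq_abs (s - t)]
  have h7 := (hκ1 s).2
  nlinarith

namespace TransportData
variable {ι : Type*} [Fintype ι] {S : TransportData ι}

/-- The time derivative prescribed by the system, at a state `v` with spatial slope `m`. -/
def rhs (S : TransportData ι) (i : ι) (t : ℝ) (v : ι → ℝ) (m : ℝ) : ℝ :=
  -S.speed i v * m + S.coeff t * S.source i v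

namespace IsMildSolution

variable {w : ℝ → ℝ → ι → ℝ} {X : ι → ℝ → ℝ → ℝ → ℝ}

lemma tendsto_dq_apply {m : ι → ℝ} {t x : ℝ} (h : Tendsto (dq w) (offDiag t x) (𝓝 m)) (i : ι) :
    Tendsto (dq fun t x => w t x i) (offDiag t x) (𝓝 (m i)) :=
  (tendsto_pi_nhds.1 h i)

lemma hasDerivWithinAt_time (hs : S.IsMildSolution w X) {m : ι → ℝ} {t x : ℝ}
    (h : Tendsto (dq w) (offDiag t x) (𝓝 m)) (ht : t ∈ Icc 0 S.T) (i : ι) :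
    HasDerivWithinAt (fun s => w s x i) (S.rhs i t (w t x) (m i)) (Icc 0 S.T) t := by
  have hX := hs.continuous_X i
  have hXtt : X i t t x = x := hs.X_eq_self i le_rfl x
  have hwX : Continuous fun z : ℝ × ℝ => w z.1 (X i z.1 z.2 x) :=
    hs.continuous_w.comp (continuous_fst.prodMk
      (hX.comp (by fun_prop : Continuous fun z : ℝ × ℝ => (z.1, z.2, x))))
  have hg1 : Continuous fun z : ℝ × ℝ => S.speed i (w z.1 (X i z.1 z.2 x)) :=
    (S.continuous_speed i).comp hwX
  have hg2 : Continuous fun z : ℝ × ℝ => S.coeff z.1 * S.source i (w z.1 (X i z.1 z.2 x)) :=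
    (S.continuous_coeff.comp continuous_fst).mul ((S.source i).continuous.comp hwX)
  rw [hasDerivWithinAt_iff_isLittleO, Asymptotics.isLittleO_iff]
  intro c hc
  obtain ⟨v, hv⟩ : ∃ v, v = S.speed i (w t x) := ⟨_, rfl⟩
  obtain ⟨η, hη⟩ : ∃ η, η = min 1 (c / (|m i| + |v| + 4)) := ⟨_, rfl⟩
  have hη0 : 0 < η := by rw [hη]; positivity
  have hη1 : η ≤ 1 := by rw [hη]; exact min_le_left _ _
  have hηc : η * (|m i| + |v| + 4) ≤ c := by
    rw [← le_div_iff₀ (by positivity), hη]; exact min_le_right _ _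
  have hy : Tendsto (fun s => (min t s, x, X i (min t s) (max t s) x)) (𝓝 t) (𝓝 (t, x, x)) := by
    have hc : Continuous fun s => (min t s, x, X i (min t s) (max t s) x) :=
      (by fun_prop : Continuous fun s : ℝ => min t s).prodMk (continuous_const.prodMk
        (hX.comp (by fun_prop : Continuous fun s : ℝ => (min t s, max t s, x))))
    simpa [hXtt] using hc.tendsto t
  have e1 := hy.eventually (eventually_norm_sub_smul_le (tendsto_dq_apply h i) hη0)
  have e2 := eventually_abs_integral_sub_le hg1 t hη0
  have e3 := eventually_abs_integral_sub_le hg2 t hη0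
  filter_upwards [nhdsWithin_le_nhds e1, nhdsWithin_le_nhds e2, nhdsWithin_le_nhds e3,
    self_mem_nhdsWithin] with s h1 h2 h3 hsm
  simp only [hXtt, ← hv] at h2 h3
  have hmin : 0 ≤ min t s := le_min ht.1 hsm.1
  have hmax : max t s ≤ S.T := max_le ht.2 hsm.2
  have e4 := hs.w_eq_add_integral i hmin min_le_max hmax x
  have e5 := hs.X_eq i hmin min_le_max hmax x
  have habs : |w s x i - w t x i - (s - t) * S.rhs i t (w t x) (m i)| =
      |w (max t s) x i - w (min t s) x i - |s - t| * S.rhs i t (w t x) (m i)| := by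
    rcases le_total t s with hts | hts
    · rw [max_eq_right hts, min_eq_left hts, abs_of_nonneg (sub_nonneg.2 hts)]
    · rw [max_eq_left hts, min_eq_right hts, abs_of_nonpos (sub_nonpos.2 hts), ← abs_neg]
      congr 1; ring
  rw [smul_eq_mul, Real.norm_eq_abs, habs, Real.norm_eq_abs]
  rw [smul_eq_mul, Real.norm_eq_abs] at h1
  generalize X i (min t s) (max t s) x = y at *
  generalize (∫ σ in min t s..max t s, S.speed i (w σ (X i σ (max t s) x))) = I at *
  generalize (∫ σ in min t s..max t s, S.coeff σ * S.source i (w σ (X i σ (max t s) x))) = J at *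
  generalize hd : |s - t| = d at *
  have hd0 : 0 ≤ d := hd ▸ abs_nonneg _
  have e6 : w (max t s) x i - w (min t s) x i - d * S.rhs i t (w t x) (m i) =
      (w (min t s) y i - w (min t s) x i - (y - x) * m i) +
        (J - d * (S.coeff t * S.source i (w t x))) - m i * (I - d * v) := by
    rw [e4, e5, rhs, hv]; ring
  have b1 : |y - x| ≤ (|v| + 1) * d := by
    have e7 : y - x = -((I - d * v) + d * v) := by rw [e5]; ring
    rw [e7, abs_neg]
    refine (abs_add_le _ _).trans ?_
    rw [abs_mul, abs_of_nonneg hd0]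
    nlinarith
  have b2 : |m i * (I - d * v)| ≤ |m i| * (η * d) := by
    rw [abs_mul]; exact mul_le_mul_of_nonneg_left h2 (abs_nonneg _)
  have b3 : η * |y - x| ≤ η * ((|v| + 1) * d) := mul_le_mul_of_nonneg_left b1 hη0.le
  rw [e6]
  refine (abs_sub _ _).trans ((add_le_add (abs_add_le _ _) le_rfl).trans ?_)
  have b4 : η * (|m i| + |v| + 4) * d ≤ c * d := mul_le_mul_of_nonneg_right hηc hd0
  have b5 : 0 ≤ η * d := by positivity
  linarith

end IsMildSolution

/-- The diagonal system has a classical solution on `[0, T] × ℝ`. -/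
theorem exists_classical_solution (S : TransportData ι) (hT : 0 < S.T) :
    ∃ w m : ℝ → ℝ → ι → ℝ, (∀ x i, w 0 x i = S.initial i x) ∧
      (∀ i, ContDiffOn ℝ 1 (fun z : ℝ × ℝ => w z.1 z.2 i) (Icc 0 S.T ×ˢ univ)) ∧
      ∀ t ∈ Icc 0 S.T, ∀ x, ‖w t x‖ ≤ 2 * S.B * S.W ∧ ‖m t x‖ ≤ 4 * S.K * S.W ∧
        ∀ i, HasDerivAt (fun y => w t y i) (m t x i) x ∧
          HasDerivAt (fun s => w s x i) (S.rhs i t (w t x) (m t x i)) t := by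
  obtain ⟨w, X, hs⟩ := S.exists_isMildSolution
  choose m hm using hs.exists_tendsto_dq
  have hmc := continuous_of_tendsto_dq hm
  have hmi : ∀ i t x, Tendsto (dq fun t x => w t x i) (offDiag t x) (𝓝 (m t x i)) :=
    fun i t x => IsMildSolution.tendsto_dq_apply (hm t x) i
  have hrc : ∀ i, Continuous fun z : ℝ × ℝ => S.rhs i z.1 (w z.1 z.2) (m z.1 z.2 i) := by
    intro i
    have h1 : Continuous fun z : ℝ × ℝ => S.speed i (w z.1 z.2) :=
      (S.continuous_speed i).comp hs.continuous_w
    have h2 : Continuous fun z : ℝ × ℝ => S.source i (w z.1 z.2) :=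
      (S.source i).continuous.comp hs.continuous_w
    have h3 : Continuous fun z : ℝ × ℝ => m z.1 z.2 i := (continuous_apply i).comp hmc
    exact (h1.neg.mul h3).add ((S.continuous_coeff.comp continuous_fst).mul h2)
  have hdt : ∀ t ∈ Icc 0 S.T, ∀ x i, HasDerivWithinAt (fun s => w s x i)
      (S.rhs i t (w t x) (m t x i)) (Icc 0 S.T) t :=
    fun t ht x i => hs.hasDerivWithinAt_time (hm t x) ht i
  have hC1 : ∀ i, ContDiffOn ℝ 1 (fun z : ℝ × ℝ => w z.1 z.2 i) (Icc 0 S.T ×ˢ univ) := by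
    intro i
    have hu : UniqueDiffOn ℝ (Icc 0 S.T ×ˢ (univ : Set ℝ)) :=
      (uniqueDiffOn_Icc hT).prod uniqueDiffOn_univ
    refine (contDiffOn_succ_iff_hasFDerivWithinAt_of_uniqueDiffOn (n := 0) hu).2
      ⟨by simp, fun z => S.rhs i z.1 (w z.1 z.2) (m z.1 z.2 i) • ContinuousLinearMap.fst ℝ ℝ ℝ +
        m z.1 z.2 i • ContinuousLinearMap.snd ℝ ℝ ℝ, ?_, fun z hz =>
        hasFDerivWithinAt_of_slices (u := fun t x => w t x i) (hmi i z.1 z.2)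
          (hdt z.1 hz.1 z.2 i)⟩
    rw [contDiffOn_zero]
    exact (((hrc i).smul continuous_const).add
      (((continuous_apply i).comp hmc).smul continuous_const)).continuousOn
  have hκ : ∀ t ∈ Icc 0 S.T, max 0 (min t S.T) = t := fun t ht => S.clamp_eq ht.1 ht.2
  obtain ⟨W, hW⟩ : ∃ W : ℝ → ℝ → ι → ℝ, W = fun t x i => w (S.clamp t) x i +
    (t - S.clamp t) * S.rhs i (S.clamp t) (w (S.clamp t) x) (m (S.clamp t) x i) := ⟨_, rfl⟩
  have hWw : ∀ t ∈ Icc 0 S.T, W t = w t := by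
    intro t ht
    ext x i
    rw [hW]
    simp only [S.clamp_eq ht.1 ht.2, sub_self, zero_mul, add_zero]
  have hK := S.K_pos
  refine ⟨W, m, fun x i => ?_, fun i => ?_, fun t ht x => ⟨?_, ?_, fun i => ⟨?_, ?_⟩⟩⟩
  · rw [hWw 0 ⟨le_rfl, hT.le⟩, hs.eq_w, wStep, S.clamp_eq le_rfl hT.le,
      intervalIntegral.integral_same, add_zero, hs.X_eq_self i le_rfl]
  · exact (hC1 i).congr fun z hz => by rw [hWw z.1 hz.1]
  · rw [hWw t ht]; exact hs.norm_w_le t x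
  · refine le_of_tendsto (hm t x).norm ?_
    refine Eventually.of_forall fun q => (hs.norm_dq_w_le q).trans ?_
    have := mul_le_mul_of_nonneg_right (S.weight_clamp_le q.1) (by positivity : 0 ≤ 4 * S.K)
    linarith
  · rw [hWw t ht]; exact hasDerivAt_of_tendsto_dq (u := fun t x => w t x i) (hmi i t x)
  · rw [hWw t ht, hW]
    exact hasDerivAt_extend (f := fun s => w s x i)
      (d := fun s => S.rhs i s (w s x) (m s x i))
      ((hrc i).comp (by fun_prop : Continuous fun s : ℝ => (s, x))) ht (hdt t ht x i)

end TransportData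

end DiagonalTransport

namespace DampedEuler
open Filter Topology MeasureTheory

/-- A power of an affine function agrees on `[-ρ, ρ]` with a globally Lipschitz `C¹` function. -/
lemma exists_lipschitz_extension {k ρ p : ℝ} (hk : 0 < k) (hρ : 0 ≤ ρ) (hkρ : k * ρ ≤ 1 / 2) :
    ∃ (F : ℝ → ℝ) (Λ : ℝ), 0 < Λ ∧ ContDiff ℝ 1 F ∧ (∀ z z', |F z - F z'| ≤ Λ * |z - z'|) ∧
      ∀ z, |z| ≤ ρ → F z = (1 + k * z) ^ p := by
  obtain ⟨κ, hκ⟩ : ∃ κ : ℝ → ℝ, κ = fun z => max (-ρ) (min z ρ) := ⟨_, rfl⟩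
  have hκc : Continuous κ := by rw [hκ]; fun_prop
  have hκm : ∀ z, κ z ∈ Icc (-ρ) ρ := fun z => by
    rw [hκ]; exact ⟨le_max_left _ _, max_le (by linarith) (min_le_right _ _)⟩
  have hpos : ∀ z ∈ Icc (-ρ) ρ, 0 < 1 + k * z := fun z hz => by nlinarith [hz.1]
  obtain ⟨d, hd⟩ : ∃ d : ℝ → ℝ, d = fun z => k * p * (1 + k * κ z) ^ (p - 1) := ⟨_, rfl⟩
  have hdc : Continuous d := by
    rw [hd]
    exact continuous_const.mul (Continuous.rpow_const (by fun_prop)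
      fun z => Or.inl (hpos _ (hκm z)).ne')
  have hbd : ∃ A, ∀ z, |d z| ≤ A := by
    obtain ⟨A, hA⟩ := (isCompact_Icc (a := -ρ) (b := ρ)).exists_bound_of_continuousOn
      (f := fun z => k * p * (1 + k * z) ^ (p - 1)) (continuousOn_const.mul
        (ContinuousOn.rpow_const (by fun_prop) fun z hz => Or.inl (hpos z hz).ne'))
    exact ⟨A, fun z => by rw [hd]; exact hA _ (hκm z)⟩
  obtain ⟨A, hA⟩ := hbd
  have hA0 : 0 ≤ A := (abs_nonneg _).trans (hA 0)
  have hF : ∀ z, HasDerivAt (fun z => 1 + ∫ y in (0 : ℝ)..z, d y) (d z) z := fun z =>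
    (intervalIntegral.integral_hasDerivAt_right (hdc.intervalIntegrable _ _)
      (hdc.stronglyMeasurableAtFilter _ _) hdc.continuousAt).const_add 1
  refine ⟨fun z => 1 + ∫ y in (0 : ℝ)..z, d y, A + 1, by positivity, ?_, fun z z' => ?_,
    fun z hz => ?_⟩
  · rw [contDiff_one_iff_deriv]
    refine ⟨fun z => (hF z).differentiableAt, ?_⟩
    rwa [funext fun z => (hF z).deriv]
  · have h := Convex.norm_image_sub_le_of_norm_hasDerivWithin_le (s := univ) (C := A + 1)
      (fun y _ => (hF y).hasDerivWithinAt) (fun y _ => (hA y).trans (by linarith)) convex_univ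
      (mem_univ z') (mem_univ z)
    exact h
  · have h : ∀ y ∈ uIcc 0 z, HasDerivAt (fun y => (1 + k * y) ^ p) (d y) y := by
      intro y hy
      have hz' := abs_le.1 hz
      have hy' : y ∈ Icc (-ρ) ρ :=
        uIcc_subset_Icc ⟨by linarith, hρ⟩ ⟨hz'.1, hz'.2⟩ hy
      have h1 : HasDerivAt (fun y => 1 + k * y) k y := by
        simpa using ((hasDerivAt_id y).const_mul k).const_add 1
      convert! h1.rpow_const (p := p) (Or.inl (hpos y hy').ne') using 1
      rw [hd, hκ]
      simp only [hy'.1, hy'.2, min_eq_left, max_eq_right]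
    simp only
    rw [intervalIntegral.integral_eq_sub_of_hasDerivAt h (hdc.intervalIntegrable _ _)]
    simp

/-- The damping coefficient, extended by a constant to negative times. -/
def coeff (lam μ t : ℝ) : ℝ := lam / (1 + max t 0) ^ μ

lemma continuous_coeff (lam μ : ℝ) : Continuous (coeff lam μ) := by
  have h : ∀ t : ℝ, 0 < 1 + max t 0 := fun t => by positivity
  unfold coeff
  exact continuous_const.div (Continuous.rpow_const (by fun_prop) fun t => Or.inl (h t).ne')
    fun t => (rpow_pos_of_pos (h t) _).ne'

lemma coeff_nonneg {lam : ℝ} (hlam : 0 ≤ lam) (μ t : ℝ) : 0 ≤ coeff lam μ t := by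
  unfold coeff; positivity

lemma coeff_of_nonneg (lam μ : ℝ) {t : ℝ} (ht : 0 ≤ t) : coeff lam μ t = lam / (1 + t) ^ μ := by
  rw [coeff, max_eq_left ht]

lemma coeff_le {lam μ : ℝ} (hlam : 0 ≤ lam) (hμ : 0 ≤ μ) (t : ℝ) : coeff lam μ t ≤ lam :=
  div_le_self hlam (one_le_rpow (by linarith [le_max_right t 0]) hμ)

lemma integral_coeff_le {lam μ t : ℝ} (hlam : 0 ≤ lam) (hμ : 1 < μ) (ht : 0 ≤ t) :
    ∫ s in (0 : ℝ)..t, coeff lam μ s ≤ lam / (μ - 1) := by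
  have hμ' : μ - 1 ≠ 0 := by linarith
  have h : ∀ s ∈ uIcc 0 t,
      HasDerivAt (fun s => -(lam / (μ - 1)) * (1 + s) ^ (1 - μ)) (coeff lam μ s) s := by
    intro s hs
    rw [uIcc_of_le ht] at hs
    have hs0 : 0 < 1 + s := by linarith [hs.1]
    have h1 : HasDerivAt (fun s : ℝ => 1 + s) 1 s := (hasDerivAt_id s).const_add 1
    convert! (h1.rpow_const (p := 1 - μ) (Or.inl hs0.ne')).const_mul (-(lam / (μ - 1))) using 1
    rw [coeff_of_nonneg _ _ hs.1, show 1 - μ - 1 = -μ by ring, rpow_neg hs0.le]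
    field_simp
    ring
  rw [intervalIntegral.integral_eq_sub_of_hasDerivAt h
    ((continuous_coeff lam μ).intervalIntegrable _ _)]
  have h1 : 0 ≤ (1 + t) ^ (1 - μ) := by positivity
  have h2 : 0 ≤ lam / (μ - 1) := div_nonneg hlam (by linarith)
  simp only [add_zero, one_rpow]
  nlinarith

/-- Initial deviation of the sound-speed potential from its rest value. -/
lemma deviation_bounds {γ ε M : ℝ} {φ : ℝ → ℝ} (hγ : 1 < γ) (hε : 0 < ε) (hφ : ContDiff ℝ 1 φ)
    (h0 : ∀ x, |φ x| ≤ M) (h1 : ∀ x, |deriv φ x| ≤ M) (hεM : ε * M ≤ 1 / 2) :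
    ContDiff ℝ 1 (fun x => 2 / (γ - 1) * ((1 + ε * φ x) ^ (-(γ - 1) / 2) - 1)) ∧
    (∀ x, |2 / (γ - 1) * ((1 + ε * φ x) ^ (-(γ - 1) / 2) - 1)| ≤ 2 ^ ((γ + 1) / 2) * (ε * M)) ∧
    ∀ x, |deriv (fun x => 2 / (γ - 1) * ((1 + ε * φ x) ^ (-(γ - 1) / 2) - 1)) x| ≤
      2 ^ ((γ + 1) / 2) * (ε * M) := by
  have hγ' : γ - 1 ≠ 0 := by linarith
  have habs : ∀ x, |ε * φ x| ≤ ε * M := fun x => by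
    rw [abs_mul, abs_of_pos hε]; exact mul_le_mul_of_nonneg_left (h0 x) hε.le
  have hu : ∀ x, 1 / 2 ≤ 1 + ε * φ x := fun x => by linarith [(abs_le.1 (habs x)).1]
  have hder : ∀ u : ℝ, 1 / 2 ≤ u → HasDerivAt
      (fun u => 2 / (γ - 1) * (u ^ (-(γ - 1) / 2) - 1)) (-u ^ (-((γ + 1) / 2))) u := by
    intro u hu
    convert! (((hasDerivAt_id u).rpow_const (p := -(γ - 1) / 2)
      (Or.inl (by simp only [id]; linarith))).sub_const 1).const_mul (2 / (γ - 1)) using 1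
    rw [show -(γ - 1) / 2 - 1 = -((γ + 1) / 2) by ring]
    simp only [id]
    field_simp
  have hH : ∀ u : ℝ, 1 / 2 ≤ u → |(-u ^ (-((γ + 1) / 2)))| ≤ 2 ^ ((γ + 1) / 2) := by
    intro u hu
    have hu0 : 0 < u := by linarith
    rw [abs_neg, abs_of_pos (by positivity)]
    have h := rpow_le_rpow_of_nonpos (by norm_num : (0 : ℝ) < 1 / 2) hu
      (by linarith : -((γ + 1) / 2) ≤ 0)
    rwa [one_div, inv_rpow (by norm_num), rpow_neg (x := 2) (by norm_num), inv_inv] at h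
  refine ⟨?_, fun x => ?_, fun x => ?_⟩
  · exact contDiff_const.mul (((contDiff_const.add (contDiff_const.mul hφ)).rpow_const_of_ne
      fun x => by linarith [hu x]).sub contDiff_const)
  · have h := Convex.norm_image_sub_le_of_norm_hasDerivWithin_le (s := Ici (1 / 2 : ℝ))
      (fun u hu => (hder u hu).hasDerivWithinAt) (fun u hu => hH u hu) (convex_Ici _)
      (show (1 : ℝ) ∈ Ici (1 / 2 : ℝ) by norm_num) (hu x)
    simp only [one_rpow, sub_self, mul_zero, sub_zero, add_sub_cancel_left, Real.norm_eq_abs] at h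
    exact h.trans (mul_le_mul_of_nonneg_left (habs x) (by positivity))
  · have hφx := ((hφ.differentiable one_ne_zero x).hasDerivAt.const_mul ε).const_add 1
    have h := (hder _ (hu x)).comp x hφx
    simp only [Function.comp_def] at h
    rw [h.deriv, abs_mul, abs_mul, abs_of_pos hε]
    exact mul_le_mul (hH _ (hu x)) (mul_le_mul_of_nonneg_left (h1 x) hε.le) (by positivity)
      (by positivity)

/-- Classical Riemann invariants give a pointwise solution of the damped Euler system. -/
lemma euler_of_riemann {γ a t x rt rx st sx : ℝ} {r s : ℝ → ℝ → ℝ} (hγ : 1 < γ)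
    (hrt : HasDerivAt (fun τ => r τ x) rt t) (hrx : HasDerivAt (fun y => r t y) rx x)
    (hst : HasDerivAt (fun τ => s τ x) st t) (hsx : HasDerivAt (fun y => s t y) sx x)
    (hy : 0 < 1 + (γ - 1) / 4 * (s t x - r t x))
    (hr : rt = (1 + (γ - 1) / 4 * (s t x - r t x)) ^ ((γ + 1) / (γ - 1)) * rx -
      a * ((r t x + s t x) / 2))
    (hs : st = -((1 + (γ - 1) / 4 * (s t x - r t x)) ^ ((γ + 1) / (γ - 1)) * sx) -
      a * ((r t x + s t x) / 2)) :
    HasDerivAt (fun τ => (1 + (γ - 1) / 4 * (s τ x - r τ x)) ^ (-2 / (γ - 1)))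
      ((rx + sx) / 2) t ∧
    HasDerivAt (fun y => (1 + (γ - 1) / 4 * (s t y - r t y)) ^ (-2 / (γ - 1)))
      (-((1 + (γ - 1) / 4 * (s t x - r t x)) ^ (-((γ + 1) / (γ - 1))) * (sx - rx) / 2)) x ∧
    HasDerivAt (fun y => pres γ ((1 + (γ - 1) / 4 * (s t y - r t y)) ^ (-2 / (γ - 1))))
      ((1 + (γ - 1) / 4 * (s t x - r t x)) ^ ((γ + 1) / (γ - 1)) * (sx - rx) / 2) x := by
  have hγ' : γ - 1 ≠ 0 := by linarith
  have hγ0 : γ ≠ 0 := by linarith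
  obtain ⟨y, hyd⟩ : ∃ y, y = 1 + (γ - 1) / 4 * (s t x - r t x) := ⟨_, rfl⟩
  obtain ⟨p, hp⟩ : ∃ p, p = (γ + 1) / (γ - 1) := ⟨_, rfl⟩
  have hpe : -2 / (γ - 1) - 1 = -p := by rw [hp]; field_simp; ring
  have hpow : ∀ (f : ℝ → ℝ) (f' z : ℝ), HasDerivAt f f' z → f z = y →
      HasDerivAt (fun ξ => f ξ ^ (-2 / (γ - 1))) (f' * (-2 / (γ - 1)) * y ^ (-p)) z := by
    intro f f' z hf hfz
    have := hf.rpow_const (p := -2 / (γ - 1)) (Or.inl (by rw [hfz, hyd]; exact hy.ne'))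
    rwa [hpe, hfz] at this
  have hyt : HasDerivAt (fun τ => 1 + (γ - 1) / 4 * (s τ x - r τ x)) ((γ - 1) / 4 * (st - rt)) t :=
    ((hst.sub hrt).const_mul _).const_add 1
  have hyx : HasDerivAt (fun y => 1 + (γ - 1) / 4 * (s t y - r t y)) ((γ - 1) / 4 * (sx - rx)) x :=
    ((hsx.sub hrx).const_mul _).const_add 1
  rw [← hyd, ← hp] at hr hs ⊢
  rw [← hyd] at hy
  have hc : y ^ p * y ^ (-p) = 1 := by rw [← rpow_add hy, add_neg_cancel, rpow_zero]
  have hux : HasDerivAt (fun y => (1 + (γ - 1) / 4 * (s t y - r t y)) ^ (-2 / (γ - 1)))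
      (-(y ^ (-p) * (sx - rx) / 2)) x := by
    convert! hpow _ _ _ hyx hyd.symm using 1
    field_simp
    ring
  refine ⟨?_, hux, ?_⟩
  · convert! hpow _ _ _ hyt hyd.symm using 1
    have h1 : st - rt = -(y ^ p * (rx + sx)) := by rw [hr, hs]; ring
    rw [h1]
    have h2 : (γ - 1) / 4 * -(y ^ p * (rx + sx)) * (-2 / (γ - 1)) * y ^ (-p) =
        (rx + sx) / 2 * (y ^ p * y ^ (-p)) := by field_simp; ring
    rw [h2, hc, mul_one]
  · have hu0 : 0 < y ^ (-2 / (γ - 1)) := rpow_pos_of_pos hy _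
    have h1 := (hux.rpow_const (p := -γ) (Or.inl (by rw [← hyd]; exact hu0.ne'))).div_const γ
    rw [← hyd, ← rpow_mul hy.le] at h1
    have h2 : -2 / (γ - 1) * (-γ - 1) = p + p := by rw [hp]; field_simp; ring
    rw [h2, rpow_add hy] at h1
    convert! h1 using 1
    have h3 : -(y ^ (-p) * (sx - rx) / 2) * -γ * (y ^ p * y ^ p) / γ =
        y ^ p * (sx - rx) / 2 * (y ^ p * y ^ (-p)) := by field_simp
    rw [h3, hc, mul_one]

open DiagonalTransport

/-- Upper bound for the integrating factor of the damped equations. -/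
def weightBound (lam μ : ℝ) : ℝ := exp (4 * (lam / (μ - 1)))

/-- The damped Euler system in Riemann invariants, with wave speed `F (s - r)`, has a `C¹`
solution up to a time inversely proportional to the size of the data. -/
theorem exists_riemann_invariants {F r₀ s₀ : ℝ → ℝ} {Λ lam μ K T : ℝ} (hF : ContDiff ℝ 1 F)
    (hΛ : 0 ≤ Λ) (hlip : ∀ z z', |F z - F z'| ≤ Λ * |z - z'|) (hlam : 0 ≤ lam) (hμ : 1 < μ)
    (hr : ContDiff ℝ 1 r₀) (hs : ContDiff ℝ 1 s₀) (hK : 0 < K)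
    (hr0 : ∀ x, |r₀ x| ≤ K) (hs0 : ∀ x, |s₀ x| ≤ K)
    (hr1 : ∀ x, |deriv r₀ x| ≤ K) (hs1 : ∀ x, |deriv s₀ x| ≤ K)
    (hT : 0 < T) (hsmall : 32 * (T * (2 * Λ) * weightBound lam μ * K) ≤ 1) :
    ∃ r s rx sx : ℝ → ℝ → ℝ, (∀ x, r 0 x = r₀ x ∧ s 0 x = s₀ x) ∧
      ContDiffOn ℝ 1 (fun z : ℝ × ℝ => r z.1 z.2) (Icc 0 T ×ˢ univ) ∧
      ContDiffOn ℝ 1 (fun z : ℝ × ℝ => s z.1 z.2) (Icc 0 T ×ˢ univ) ∧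
      ∀ t ∈ Icc 0 T, ∀ x,
        (|r t x| ≤ 2 * K * weightBound lam μ ∧ |s t x| ≤ 2 * K * weightBound lam μ) ∧
        (|rx t x| ≤ 4 * K * weightBound lam μ ∧ |sx t x| ≤ 4 * K * weightBound lam μ) ∧
        HasDerivAt (fun y => r t y) (rx t x) x ∧ HasDerivAt (fun y => s t y) (sx t x) x ∧
        HasDerivAt (fun τ => r τ x)
          (F (s t x - r t x) * rx t x - coeff lam μ t * ((r t x + s t x) / 2)) t ∧
        HasDerivAt (fun τ => s τ x)
          (-(F (s t x - r t x) * sx t x) - coeff lam μ t * ((r t x + s t x) / 2)) t := by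
  have hc := continuous_coeff lam μ
  have hcoord : ∀ (v : Fin 2 → ℝ) i, |v i| ≤ ‖v‖ := fun v i => norm_le_pi_norm v i
  have hspeed : ∀ v v' : Fin 2 → ℝ,
      |F (v 1 - v 0) - F (v' 1 - v' 0)| ≤ 2 * Λ * ‖v - v'‖ := fun v v' => by
    have h0 := hcoord (v - v') 0
    have h1 := hcoord (v - v') 1
    rw [Pi.sub_apply] at h0 h1
    have h : |v 1 - v 0 - (v' 1 - v' 0)| ≤ 2 * ‖v - v'‖ := by
      rw [show v 1 - v 0 - (v' 1 - v' 0) = (v 1 - v' 1) - (v 0 - v' 0) by ring]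
      linarith [abs_sub (v 1 - v' 1) (v 0 - v' 0)]
    exact (hlip _ _).trans (by nlinarith)
  have hFc : ContDiff ℝ 1 fun v : Fin 2 → ℝ => F (v 1 - v 0) := hF.comp (by fun_prop)
  let S : TransportData (Fin 2) :=
    { speed := ![fun v => -F (v 1 - v 0), fun v => F (v 1 - v 0)]
      source := fun _ => (-(1 / 2 : ℝ)) •
        (ContinuousLinearMap.proj (R := ℝ) (φ := fun _ : Fin 2 => ℝ) 0 +
          ContinuousLinearMap.proj (R := ℝ) (φ := fun _ : Fin 2 => ℝ) 1)
      coeff := coeff lam μ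
      weight := fun t => exp (4 * ∫ τ in (0 : ℝ)..t, coeff lam μ τ)
      initial := ![r₀, s₀]
      T := T
      L := 2 * Λ
      K := K
      W := weightBound lam μ
      B := K
      T_nonneg := hT.le
      L_nonneg := by positivity
      K_pos := hK
      B_nonneg := hK.le
      contDiff_speed := by
        intro i; fin_cases i
        · exact hFc.neg
        · exact hFc
      speed_lipschitz := by
        intro i v v'; fin_cases i
        · simpa only [Fin.zero_eta, Matrix.cons_val_zero, neg_sub_neg, norm_sub_rev v] using
            hspeed v' v
        · exact hspeed v v'
      source_le := by
        intro i v
        have h0 := hcoord v 0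
        have h1 := hcoord v 1
        have h := abs_add_le (v 0) (v 1)
        change |-(1 / 2 : ℝ) * (v 0 + v 1)| ≤ ‖v‖
        rw [abs_mul, abs_neg, abs_of_pos (by norm_num : (0 : ℝ) < 1 / 2)]
        linarith
      continuous_coeff := hc
      coeff_nonneg := coeff_nonneg hlam μ
      hasDerivAt_weight := fun t => by
        convert! ((intervalIntegral.integral_hasDerivAt_right (hc.intervalIntegrable 0 t)
          (hc.stronglyMeasurableAtFilter _ _) hc.continuousAt).const_mul 4).exp using 1
        ring
      weight_zero := by simp
      one_le_weight := fun t ht => one_le_exp (mul_nonneg (by norm_num)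
        (intervalIntegral.integral_nonneg ht fun τ _ => coeff_nonneg hlam μ τ))
      weight_le := fun t ht _ => exp_le_exp.2
        (mul_le_mul_of_nonneg_left (integral_coeff_le hlam hμ ht) (by norm_num))
      contDiff_initial := by
        intro i; fin_cases i
        exacts [hr, hs]
      abs_initial_le := by
        intro i; fin_cases i
        exacts [hr0, hs0]
      abs_deriv_initial_le := by
        intro i; fin_cases i
        exacts [hr1, hs1]
      small := hsmall }
  obtain ⟨w, m, h0, hC, h⟩ := S.exists_classical_solution hT
  refine ⟨fun t x => w t x 0, fun t x => w t x 1, fun t x => m t x 0, fun t x => m t x 1,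
    fun x => ⟨h0 x 0, h0 x 1⟩, hC 0, hC 1, fun t ht x => ?_⟩
  obtain ⟨hw, hm, hd⟩ := h t ht x
  refine ⟨⟨(hcoord _ _).trans hw, (hcoord _ _).trans hw⟩,
    ⟨(hcoord _ _).trans hm, (hcoord _ _).trans hm⟩, (hd 0).1, (hd 1).1, ?_, ?_⟩
  · convert! (hd 0).2 using 1
    change _ = -(-F (w t x 1 - w t x 0)) * m t x 0 +
      coeff lam μ t * (-(1 / 2 : ℝ) * (w t x 0 + w t x 1))
    ring
  · convert! (hd 1).2 using 1
    change _ = -F (w t x 1 - w t x 0) * m t x 1 +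
      coeff lam μ t * (-(1 / 2 : ℝ) * (w t x 0 + w t x 1))
    ring

/-- A power of a positive quantity bounded above and away from zero is bounded. -/
lemma exists_rpow_bound (e : ℝ) : ∃ A, 0 ≤ A ∧ ∀ y ∈ Icc (1 / 2 : ℝ) (3 / 2), |y ^ e| ≤ A := by
  obtain ⟨A, hA⟩ := (isCompact_Icc (a := (1 / 2 : ℝ)) (b := 3 / 2)).exists_bound_of_continuousOn
    (f := fun y => y ^ e) (ContinuousOn.rpow_const continuousOn_id fun y hy =>
      Or.inl (by linarith [hy.1]))
  exact ⟨A, (norm_nonneg _).trans (hA 1 (by norm_num)), hA⟩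

/-- Bounded Riemann invariants with bounded slopes reconstruct a `C¹_b` solution. -/
theorem isEulerOn_of_riemann {γ lam μ T D : ℝ} {r s rx sx rt st : ℝ → ℝ → ℝ} (hγ : 1 < γ)
    (hlam : 0 ≤ lam) (hμ : 1 < μ)
    (hrC : IsC1On r (strip T)) (hsC : IsC1On s (strip T))
    (hy : ∀ t ∈ Icc 0 T, ∀ x, |(γ - 1) / 4 * (s t x - r t x)| ≤ 1 / 2)
    (hb : ∀ t ∈ Icc 0 T, ∀ x, |r t x| ≤ D ∧ |s t x| ≤ D ∧ |rx t x| ≤ D ∧ |sx t x| ≤ D)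
    (hrx : ∀ t ∈ Icc 0 T, ∀ x, HasDerivAt (fun y => r t y) (rx t x) x)
    (hsx : ∀ t ∈ Icc 0 T, ∀ x, HasDerivAt (fun y => s t y) (sx t x) x)
    (hrt : ∀ t ∈ Icc 0 T, ∀ x, HasDerivAt (fun τ => r τ x) (rt t x) t)
    (hst : ∀ t ∈ Icc 0 T, ∀ x, HasDerivAt (fun τ => s τ x) (st t x) t)
    (hr : ∀ t ∈ Icc 0 T, ∀ x, rt t x =
      (1 + (γ - 1) / 4 * (s t x - r t x)) ^ ((γ + 1) / (γ - 1)) * rx t x -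
        coeff lam μ t * ((r t x + s t x) / 2))
    (hs : ∀ t ∈ Icc 0 T, ∀ x, st t x =
      -((1 + (γ - 1) / 4 * (s t x - r t x)) ^ ((γ + 1) / (γ - 1)) * sx t x) -
        coeff lam μ t * ((r t x + s t x) / 2)) :
    IsC1bOn (fun t x => (1 + (γ - 1) / 4 * (s t x - r t x)) ^ (-2 / (γ - 1))) (strip T) ∧
    IsC1bOn (fun t x => (r t x + s t x) / 2) (strip T) ∧
    IsEulerOn γ lam μ (fun t x => (1 + (γ - 1) / 4 * (s t x - r t x)) ^ (-2 / (γ - 1)))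
      (fun t x => (r t x + s t x) / 2) (strip T) ∧
    ∀ p ∈ strip T,
      0 < (1 + (γ - 1) / 4 * (s p.1 p.2 - r p.1 p.2)) ^ (-2 / (γ - 1)) := by
  have hyI : ∀ t ∈ Icc 0 T, ∀ x,
      1 + (γ - 1) / 4 * (s t x - r t x) ∈ Icc (1 / 2 : ℝ) (3 / 2) := fun t ht x => by
    have := abs_le.1 (hy t ht x); constructor <;> linarith
  have hy0 : ∀ t ∈ Icc 0 T, ∀ x, 0 < 1 + (γ - 1) / 4 * (s t x - r t x) := fun t ht x => by
    linarith [(hyI t ht x).1]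
  have he := fun t (ht : t ∈ Icc 0 T) x => euler_of_riemann hγ (hrt t ht x) (hrx t ht x)
    (hst t ht x) (hsx t ht x) (hy0 t ht x) (hr t ht x) (hs t ht x)
  have hvx := fun t (ht : t ∈ Icc 0 T) x => ((hrx t ht x).add (hsx t ht x)).div_const 2
  have hvt := fun t (ht : t ∈ Icc 0 T) x => ((hrt t ht x).add (hst t ht x)).div_const 2
  obtain ⟨A₁, hA₁, h₁⟩ := exists_rpow_bound (-2 / (γ - 1))
  obtain ⟨A₂, hA₂, h₂⟩ := exists_rpow_bound (-((γ + 1) / (γ - 1)))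
  obtain ⟨A₃, hA₃, h₃⟩ := exists_rpow_bound ((γ + 1) / (γ - 1))
  have hmean : ∀ a b : ℝ, |a| ≤ D → |b| ≤ D → |(a + b) / 2| ≤ D := fun a b ha hb => by
    rw [abs_le] at *; constructor <;> linarith
  have hdiff : ∀ a b : ℝ, |a| ≤ D → |b| ≤ D → |(a - b) / 2| ≤ D := fun a b ha hb => by
    rw [abs_le] at *; constructor <;> linarith
  refine ⟨⟨?_, A₁ + D + A₂ * D, fun ⟨t, x⟩ hp => ?_⟩,
    ⟨?_, D + (A₃ * D + lam * D) + D, fun ⟨t, x⟩ hp => ?_⟩, fun ⟨t, x⟩ hp => ?_, fun ⟨t, x⟩ hp => ?_⟩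
  · exact ContDiffOn.rpow_const_of_ne (contDiffOn_const.add (contDiffOn_const.mul (hsC.sub hrC)))
      fun p hp => (hy0 p.1 hp.1 p.2).ne'
  · obtain ⟨hut, hux, -⟩ := he t hp.1 x
    obtain ⟨-, -, hD₁, hD₂⟩ := hb t hp.1 x
    simp only [pdt, pdx, hut.deriv, hux.deriv]
    refine add_le_add (add_le_add (h₁ _ (hyI t hp.1 x)) (hmean _ _ hD₁ hD₂)) ?_
    rw [abs_neg, mul_div_assoc, abs_mul]
    exact mul_le_mul (h₂ _ (hyI t hp.1 x)) (hdiff _ _ hD₂ hD₁) (abs_nonneg _) hA₂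
  · exact (hrC.add hsC).div_const 2
  · obtain ⟨hD₀, hD₀', hD₁, hD₂⟩ := hb t hp.1 x
    have hvt' := (hvt t hp.1 x).deriv
    have hvx' := (hvx t hp.1 x).deriv
    simp only [Pi.add_def] at hvt' hvx'
    simp only [pdt, pdx, hvt', hvx']
    refine add_le_add (add_le_add (hmean _ _ hD₀ hD₀') ?_) (hmean _ _ hD₁ hD₂)
    rw [hr t hp.1 x, hs t hp.1 x]
    obtain ⟨P, hP⟩ : ∃ P, P = (1 + (γ - 1) / 4 * (s t x - r t x)) ^ ((γ + 1) / (γ - 1)) := ⟨_, rfl⟩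
    rw [← hP]
    rw [show (P * rx t x - coeff lam μ t * ((r t x + s t x) / 2) +
      (-(P * sx t x) - coeff lam μ t * ((r t x + s t x) / 2))) / 2 =
      P * ((rx t x - sx t x) / 2) - coeff lam μ t * ((r t x + s t x) / 2) by ring]
    refine (abs_sub _ _).trans (add_le_add ?_ ?_)
    · rw [abs_mul]
      exact mul_le_mul (hP ▸ h₃ _ (hyI t hp.1 x)) (hdiff _ _ hD₁ hD₂) (abs_nonneg _) hA₃
    · rw [abs_mul, abs_of_nonneg (coeff_nonneg hlam μ t)]
      exact mul_le_mul (coeff_le hlam (by linarith) t) (hmean _ _ hD₀ hD₀') (abs_nonneg _) hlam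
  · obtain ⟨hut, hux, hpx⟩ := he t hp.1 x
    have hvt' := (hvt t hp.1 x).deriv
    have hvx' := (hvx t hp.1 x).deriv
    simp only [Pi.add_def] at hvt' hvx'
    simp only [pdt, pdx, hut.deriv, hpx.deriv, hvt', hvx']
    refine ⟨by ring, ?_⟩
    rw [hr t hp.1 x, hs t hp.1 x, coeff_of_nonneg _ _ hp.1.1]
    ring
  · exact rpow_pos_of_pos (hy0 t hp.1 x) _

end DampedEuler

/-- For `μ > 1` and `λ ≥ 0`, the lifespan satisfies
`T* ≥ C ε⁻¹`: the solution exists as a `C¹_b` solution with `u > 0` on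
`[0, Cε⁻¹] × ℝ`. -/
theorem lifespan_lower_bound_mu_gt_one
    (γ lam μ : ℝ) (φ ψ : ℝ → ℝ) (hγ : 1 < γ)
    (hφ : IsC1b φ) (hψ : IsC1b ψ) (hμ : 1 < μ) (hlam : 0 ≤ lam) :
    ∃ ε₀ > 0, ∃ C > 0, ∀ ε : ℝ, 0 < ε → ε ≤ ε₀ →
      ∃ u v : ℝ → ℝ → ℝ,
        IsC1bOn u (strip (C * ε⁻¹)) ∧ IsC1bOn v (strip (C * ε⁻¹)) ∧
        IsEulerOn γ lam μ u v (strip (C * ε⁻¹)) ∧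
        (∀ x, u 0 x = 1 + ε * φ x ∧ v 0 x = ε * ψ x) ∧
        (∀ p ∈ strip (C * ε⁻¹), 0 < u p.1 p.2) := by
  obtain ⟨hφC, Mφ, hMφ⟩ := hφ
  obtain ⟨hψC, Mψ, hMψ⟩ := hψ
  obtain ⟨M, hM, hφ₀, hφ₁, hψ₀, hψ₁⟩ : ∃ M > 0, (∀ x, |φ x| ≤ M) ∧ (∀ x, |deriv φ x| ≤ M) ∧
      (∀ x, |ψ x| ≤ M) ∧ ∀ x, |deriv ψ x| ≤ M := by
    refine ⟨|Mφ| + |Mψ| + 1, by positivity, fun x => ?_, fun x => ?_, fun x => ?_, fun x => ?_⟩ <;>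
    linarith [hMφ x, hMψ x, abs_nonneg (φ x), abs_nonneg (deriv φ x), abs_nonneg (ψ x),
      abs_nonneg (deriv ψ x), le_abs_self Mφ, le_abs_self Mψ, abs_nonneg Mφ, abs_nonneg Mψ]
  have hγ₀ : 0 < γ - 1 := by linarith
  obtain ⟨F, Λ, hΛ, hF, hlip, hFeq⟩ := DampedEuler.exists_lipschitz_extension
    (k := (γ - 1) / 4) (ρ := 2 / (γ - 1)) (p := (γ + 1) / (γ - 1)) (by positivity) (by positivity)
    (by field_simp; norm_num)
  obtain ⟨W, hWd⟩ : ∃ W, W = DampedEuler.weightBound lam μ := ⟨_, rfl⟩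
  have hW : 0 < W := hWd ▸ exp_pos _
  obtain ⟨K, hK⟩ : ∃ K, K = M + 2 ^ ((γ + 1) / 2) * M := ⟨_, rfl⟩
  have hK₀ : 0 < K := by rw [hK]; positivity
  refine ⟨min (1 / (2 * M)) (2 / (γ - 1) / (4 * K * W)), by positivity, 1 / (64 * Λ * W * K),
    by positivity, fun ε hε hεε => ?_⟩
  have hεM : ε * M ≤ 1 / 2 := by
    have h := (le_div_iff₀ (by positivity)).1 (hεε.trans (min_le_left _ _))
    linarith
  have hερ : ε * (4 * K * W) ≤ 2 / (γ - 1) :=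
    (le_div_iff₀ (by positivity)).1 (hεε.trans (min_le_right _ _))
  obtain ⟨hηC, hη₀, hη₁⟩ := DampedEuler.deviation_bounds hγ hε hφC hφ₀ hφ₁ hεM
  obtain ⟨η, hη⟩ : ∃ η : ℝ → ℝ,
    η = fun x => 2 / (γ - 1) * ((1 + ε * φ x) ^ (-(γ - 1) / 2) - 1) := ⟨_, rfl⟩
  rw [← hη] at hηC hη₁
  have hη₀' : ∀ x, |η x| ≤ 2 ^ ((γ + 1) / 2) * (ε * M) := by rw [hη]; exact hη₀
  have hεψC : ContDiff ℝ 1 fun x => ε * ψ x := contDiff_const.mul hψC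
  have hεψ₀ : ∀ x, |ε * ψ x| ≤ ε * M := fun x => by
    rw [abs_mul, abs_of_pos hε]; exact mul_le_mul_of_nonneg_left (hψ₀ x) hε.le
  have hεψ₁ : ∀ x, |deriv (fun x => ε * ψ x) x| ≤ ε * M := fun x => by
    rw [((hψC.differentiable one_ne_zero x).hasDerivAt.const_mul ε).deriv, abs_mul, abs_of_pos hε]
    exact mul_le_mul_of_nonneg_left (hψ₁ x) hε.le
  have hεK : ε * M + 2 ^ ((γ + 1) / 2) * (ε * M) = ε * K := by rw [hK]; ring
  have hdψ := fun x => hεψC.differentiable one_ne_zero x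
  have hdη := fun x => hηC.differentiable one_ne_zero x
  obtain ⟨r, s, rx, sx, h0, hrC, hsC, h⟩ := DampedEuler.exists_riemann_invariants
    (r₀ := (fun x => ε * ψ x) - η) (s₀ := (fun x => ε * ψ x) + η) (K := ε * K)
    (T := 1 / (64 * Λ * W * K) * ε⁻¹) hF hΛ.le hlip hlam hμ (hεψC.sub hηC) (hεψC.add hηC)
    (by positivity)
    (fun x => hεK ▸ (abs_sub _ _).trans (add_le_add (hεψ₀ x) (hη₀' x)))
    (fun x => hεK ▸ (abs_add_le _ _).trans (add_le_add (hεψ₀ x) (hη₀' x)))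
    (fun x => by
      rw [deriv_sub (hdψ x) (hdη x)]
      exact hεK ▸ (abs_sub _ _).trans (add_le_add (hεψ₁ x) (hη₁ x)))
    (fun x => by
      rw [deriv_add (hdψ x) (hdη x)]
      exact hεK ▸ (abs_add_le _ _).trans (add_le_add (hεψ₁ x) (hη₁ x)))
    (by positivity) (by rw [← hWd]; field_simp; norm_num)
  rw [← hWd] at h
  have hz : ∀ t ∈ Icc 0 (1 / (64 * Λ * W * K) * ε⁻¹), ∀ x,
      |s t x - r t x| ≤ 2 / (γ - 1) := fun t ht x => by
    obtain ⟨⟨h₁, h₂⟩, -⟩ := h t ht x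
    linarith [abs_sub (s t x) (r t x)]
  have hFz := fun t (ht : t ∈ Icc 0 (1 / (64 * Λ * W * K) * ε⁻¹)) x => hFeq _ (hz t ht x)
  have hεKW : 0 < ε * K * W := by positivity
  obtain ⟨hu, hv, hE, hpos⟩ := DampedEuler.isEulerOn_of_riemann (D := 4 * (ε * K) * W)
    (lam := lam) (μ := μ) (rx := rx) (sx := sx) hγ hlam hμ hrC hsC
    (fun t ht x => by
      rw [abs_mul, abs_of_pos (by positivity)]
      refine (mul_le_mul_of_nonneg_left (hz t ht x) (by positivity)).trans_eq ?_
      field_simp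
      norm_num)
    (fun t ht x => by
      obtain ⟨⟨h₁, h₂⟩, ⟨h₃, h₄⟩, -⟩ := h t ht x
      exact ⟨by linarith, by linarith, h₃, h₄⟩)
    (fun t ht x => (h t ht x).2.2.1) (fun t ht x => (h t ht x).2.2.2.1)
    (fun t ht x => (h t ht x).2.2.2.2.1) (fun t ht x => (h t ht x).2.2.2.2.2)
    (fun t ht x => by rw [hFz t ht x]) (fun t ht x => by rw [hFz t ht x])
  refine ⟨_, _, hu, hv, hE, fun x => ?_, hpos⟩
  have hu₀ : 0 < 1 + ε * φ x := by
    have h₁ : |ε * φ x| ≤ ε * M := by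
      rw [abs_mul, abs_of_pos hε]; exact mul_le_mul_of_nonneg_left (hφ₀ x) hε.le
    linarith [(abs_le.1 h₁).1]
  obtain ⟨hr₀, hs₀⟩ := h0 x
  simp only [hr₀, hs₀, Pi.add_apply, Pi.sub_apply]
  refine ⟨?_, by ring⟩
  rw [show 1 + (γ - 1) / 4 * (ε * ψ x + η x - (ε * ψ x - η x)) =
    (1 + ε * φ x) ^ (-(γ - 1) / 2) by rw [hη]; field_simp; ring, ← rpow_mul hu₀.le,
    show -(γ - 1) / 2 * (-2 / (γ - 1)) = 1 by field_simp, rpow_one]
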